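/- There is an absolute constant C with the following property. Let k ∈ ℂ⁺ and let f ∈ C_c^∞(ℝ³ ∖ {0}; ℂ³) be a smooth vector field whose compact support avoids the origin. For r > 0 and σ ∈ S² define μ₁(r,σ) := r ∫_{ℝ³} [e^{ik(−r+|rσ−y|+|y|)} / (4π |rσ−y| |y|)] · ( |y|² div_y(f(y)/|y|) ) dy. Then sup_{r>0} ‖μ₁(r,·)‖_{L²(S²)} ≤ C ( 1/|k|² + 1/(Im k)² + |k|/(Im k)^{3/2} + |k|/(Im k)² + 1/(Im k) )^{1/2} ‖f‖_{L²(ℝ³)}. -/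

import Mathlib

open MeasureTheory Metric

noncomputable section

/-- The kernel `e^{ik(−r+|rσ−y|+|y|)} / (4π |rσ−y| |y|)`. -/
def ker (k : ℂ) (r : ℝ) (σ y : EuclideanSpace ℝ (Fin 3)) : ℂ :=
  Complex.exp (Complex.I * k * ((-r + ‖r • σ - y‖ + ‖y‖ : ℝ) : ℂ)) /
    ((4 * Real.pi * ‖r • σ - y‖ * ‖y‖ : ℝ) : ℂ)

/-- Divergence of a `ℂ³`-valued vector field on `ℝ³`. -/
def cdiv (g : EuclideanSpace ℝ (Fin 3) → EuclideanSpace ℂ (Fin 3))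
    (y : EuclideanSpace ℝ (Fin 3)) : ℂ :=
  ∑ i : Fin 3, fderiv ℝ (fun z => g z i) y (EuclideanSpace.single i 1)

/-- `μ₁(r,σ) = r ∫ ker(k,r,σ,y) · (|y|² div(f/|y|))(y) dy`. -/
def mu1 (k : ℂ) (f : EuclideanSpace ℝ (Fin 3) → EuclideanSpace ℂ (Fin 3))
    (r : ℝ) (σ : EuclideanSpace ℝ (Fin 3)) : ℂ :=
  (r : ℂ) * ∫ y : EuclideanSpace ℝ (Fin 3),
    ker k r σ y * (((‖y‖ : ℝ) : ℂ) ^ 2 * cdiv (fun z => ‖z‖⁻¹ • f z) y)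

end

local notation "E3" => EuclideanSpace ℝ (Fin 3)

theorem polar_lintegral (F : E3 → ENNReal) (hF : Measurable F) :
    ∫⁻ x, F x = ∫⁻ s : sphere (0 : E3) 1, ∫⁻ r in Set.Ioi (0 : ℝ),
      ENNReal.ofReal (r ^ 2) * F (r • (s : E3)) ∂volume ∂(volume : Measure E3).toSphere := by
  have h1 : ∫⁻ x, F x = ∫⁻ x : ({(0 : E3)}ᶜ : Set E3), F x ∂(Measure.comap Subtype.val volume) := by
    rw [lintegral_subtype_comap (measurableSet_singleton _).compl, restrict_compl_singleton]
  have mp := (volume : Measure E3).measurePreserving_homeomorphUnitSphereProd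
  have h2 := mp.lintegral_comp_emb (Homeomorph.measurableEmbedding _)
    (fun p => F (p.2.1 • (p.1 : E3)))
  have h3 : ∀ x : ({(0 : E3)}ᶜ : Set E3), F x = F (((homeomorphUnitSphereProd E3 x).2 : ℝ) •
      ((homeomorphUnitSphereProd E3 x).1 : E3)) := by
    intro x
    have := homeomorphUnitSphereProd_symm_apply_coe E3 (homeomorphUnitSphereProd E3 x)
    rw [← this]; simp
  rw [h1, lintegral_congr h3, h2]
  have hm : Measurable (fun p : sphere (0 : E3) 1 × Set.Ioi (0:ℝ) => F (p.2.1 • (p.1 : E3))) := by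
    apply hF.comp
    fun_prop
  rw [lintegral_prod _ hm.aemeasurable]
  congr 1; ext s
  have hfr : Module.finrank ℝ E3 - 1 = 2 := by simp
  rw [hfr, Measure.volumeIoiPow, lintegral_withDensity_eq_lintegral_mul]
  · rw [← lintegral_subtype_comap measurableSet_Ioi]
    rfl
  · fun_prop
  · exact hm.comp (by fun_prop : Measurable fun r => (s, r))

theorem polar_integral (F : E3 → ℂ) (hF : Integrable F) :
    ∫ x, F x = ∫ s : sphere (0 : E3) 1, ∫ r in Set.Ioi (0 : ℝ),
      ((r : ℂ) ^ 2) * F (r • (s : E3)) ∂volume ∂(volume : Measure E3).toSphere := by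
  have h1 : ∫ x, F x = ∫ x : ({(0 : E3)}ᶜ : Set E3), F x ∂(Measure.comap Subtype.val volume) := by
    rw [integral_subtype_comap (measurableSet_singleton _).compl, restrict_compl_singleton]
  have mp := (volume : Measure E3).measurePreserving_homeomorphUnitSphereProd
  have h2 := mp.integral_comp (Homeomorph.measurableEmbedding _)
    (fun p => F (p.2.1 • (p.1 : E3)))
  have h3 : ∀ x : ({(0 : E3)}ᶜ : Set E3), F x = F (((homeomorphUnitSphereProd E3 x).2 : ℝ) •
      ((homeomorphUnitSphereProd E3 x).1 : E3)) := by
    intro x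
    have := homeomorphUnitSphereProd_symm_apply_coe E3 (homeomorphUnitSphereProd E3 x)
    rw [← this]; simp
  have hi : Integrable (fun x : ({(0 : E3)}ᶜ : Set E3) => F x) (Measure.comap Subtype.val volume) := by
    have := hF.integrableOn (s := {(0 : E3)}ᶜ)
    rwa [integrableOn_iff_comap_subtypeVal (measurableSet_singleton _).compl] at this
  rw [h1, integral_congr_ae (Filter.Eventually.of_forall h3), h2]
  have hi2 := (mp.integrable_comp_emb (Homeomorph.measurableEmbedding _)
    (g := fun p => F (p.2.1 • (p.1 : E3)))).1 (hi.congr (Filter.Eventually.of_forall h3))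
  rw [integral_prod _ hi2]
  congr 1; ext s
  have hfr : Module.finrank ℝ E3 - 1 = 2 := by simp
  rw [hfr, Measure.volumeIoiPow]
  simp only [ENNReal.ofReal]
  rw [integral_withDensity_eq_integral_smul]
  · rw [← integral_subtype_comap measurableSet_Ioi]
    congr 1; ext r
    rw [NNReal.smul_def, Real.coe_toNNReal _ (by positivity)]
    simp
  · fun_prop

/-- Integral of a derivative vanishes, with a mild singularity allowed at the origin. -/
theorem ibp0 (F F' : E3 → ℂ) (v : E3)
    (hd : ∀ x, x ≠ 0 → HasLineDerivAt ℝ F (F' x) x v)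
    (hF : Integrable F) (hF1 : Integrable (fun x => ‖x‖⁻¹ * ‖F x‖)) (hF' : Integrable F') :
    ∫ x, F' x = 0 := by
  let b : ContDiffBump (0 : E3) := ⟨1, 2, by norm_num, by norm_num⟩
  let χ : ℕ → E3 → ℝ := fun n x => 1 - b ((n + 1 : ℝ) • x)
  let χ' : ℕ → E3 → ℝ := fun n x => -((n + 1 : ℝ) * fderiv ℝ b ((n + 1 : ℝ) • x) v)
  have hbd : Differentiable ℝ b := (b.contDiff (n := 1)).differentiable (by norm_num)
  have hχ : ∀ n x, HasLineDerivAt ℝ (χ n) (χ' n x) x v := by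
    intro n x
    have h1 : HasFDerivAt (fun x : E3 => (n + 1 : ℝ) • x)
      ((n + 1 : ℝ) • ContinuousLinearMap.id ℝ E3) x := (hasFDerivAt_id x).const_smul (n + 1 : ℝ)
    have h2 := ((hbd ((n + 1 : ℝ) • x)).hasFDerivAt.comp x h1).const_sub 1
    convert! h2.hasLineDerivAt v using 1
    simp [χ']
  have hfc : Continuous (fderiv ℝ b) := (b.contDiff (n := 1)).continuous_fderiv (by norm_num)
  obtain ⟨K, hK⟩ : ∃ K, ∀ x, ‖fderiv ℝ b x‖ ≤ K :=
    (b.hasCompactSupport.fderiv ℝ).exists_bound_of_continuous hfc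
  have hK0 : 0 ≤ K := (norm_nonneg _).trans (hK 0)
  have hχ'b : ∀ n x, |χ' n x| ≤ 2 * K * ‖v‖ * ‖x‖⁻¹ := by
    intro n x
    have hn : (0:ℝ) < n + 1 := by positivity
    by_cases hx : ‖(n + 1 : ℝ) • x‖ ≤ 2
    · rw [norm_smul, Real.norm_of_nonneg hn.le] at hx
      rcases eq_or_ne x 0 with rfl | hx0
      · have : fderiv ℝ b (0 : E3) = 0 := by
          have : (b : E3 → ℝ) =ᶠ[nhds 0] fun _ => 1 := by
            exact b.eventuallyEq_one
          rw [this.fderiv_eq]; simp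
        simp [χ', this]
      · have hxp : 0 < ‖x‖ := norm_pos_iff.2 hx0
        have : |χ' n x| ≤ (n + 1) * (K * ‖v‖) := by
          simp only [χ', abs_neg, abs_mul, abs_of_pos hn]
          gcongr
          exact ((fderiv ℝ b ((n + 1 : ℝ) • x)).le_opNorm v).trans (by gcongr; exact hK _)
        refine this.trans ?_
        have h3 : (n + 1 : ℝ) ≤ 2 * ‖x‖⁻¹ := by
          rw [← div_eq_mul_inv, le_div_iff₀ hxp]; exact hx
        calc (n + 1 : ℝ) * (K * ‖v‖) ≤ (2 * ‖x‖⁻¹) * (K * ‖v‖) := by gcongr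
          _ = _ := by ring
    · push Not at hx
      have : fderiv ℝ b ((n + 1 : ℝ) • x) = 0 := by
        have h : (n + 1 : ℝ) • x ∉ tsupport b := by
          rw [b.tsupport_eq]; simpa using hx
        have := Set.notMem_subset (tsupport_fderiv_subset ℝ (f := b)) h
        exact image_eq_zero_of_notMem_tsupport this
      simp only [χ', this]; simp; positivity
  have hχ'0 : ∀ x, x ≠ 0 → ∀ᶠ n : ℕ in Filter.atTop, χ n x = 1 ∧ χ' n x = 0 := by
    intro x hx
    have hxp : 0 < ‖x‖ := norm_pos_iff.2 hx
    obtain ⟨N, hN⟩ := exists_nat_gt (2 / ‖x‖)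
    filter_upwards [Filter.eventually_ge_atTop N] with n hn
    have h : 2 < ‖(n + 1 : ℝ) • x‖ := by
      rw [norm_smul, Real.norm_of_nonneg (by positivity)]
      rw [div_lt_iff₀ hxp] at hN
      have : (N:ℝ) ≤ n := by exact_mod_cast hn
      nlinarith
    have h : (n + 1 : ℝ) • x ∉ tsupport b := by
      rw [b.tsupport_eq]; simpa using h
    refine ⟨?_, ?_⟩
    · simp [χ, image_eq_zero_of_notMem_tsupport h]
    · have := Set.notMem_subset (tsupport_fderiv_subset ℝ (f := b)) h
      simp [χ', image_eq_zero_of_notMem_tsupport this]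
  have hχ1 : ∀ n x, |χ n x| ≤ 1 := by
    intro n x
    have h1 := b.nonneg' ((n + 1 : ℝ) • x)
    have h2 := b.le_one (x := (n + 1 : ℝ) • x)
    simp only [χ]; rw [abs_le]; constructor <;> linarith
  have hχc : ∀ n, Continuous (χ n) := by
    intro n
    have := b.continuous
    simp only [χ]; fun_prop
  have hχ'c : ∀ n, Continuous (χ' n) := by
    intro n
    simp only [χ']; fun_prop
  have hI1 : ∀ n, Integrable (fun x => χ' n x • F x) := by
    intro n
    refine (hF1.const_mul (2 * K * ‖v‖)).mono' ((hχ'c n).aestronglyMeasurable.smul hF.1) ?_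
    refine Filter.Eventually.of_forall fun x => ?_
    rw [norm_smul, ← mul_assoc]
    gcongr
    exact hχ'b n x
  have key : ∀ n, ∫ x, χ n x • F' x = - ∫ x, χ' n x • F x := by
    intro n
    refine integral_bilinear_hasLineDerivAt_right_eq_neg_left_of_integrable
      (B := ContinuousLinearMap.lsmul ℝ ℝ) (f := χ n) (f' := χ' n) (g := F) (g' := F') (v := v)
      (hI1 n) ?_ ?_ (fun x _ => hχ n x) ?_
    · refine hF'.norm.mono' ((hχc n).aestronglyMeasurable.smul hF'.1) ?_
      refine Filter.Eventually.of_forall fun x => ?_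
      simp only [ContinuousLinearMap.lsmul_apply, norm_smul]
      exact mul_le_of_le_one_left (norm_nonneg _) (hχ1 n x)
    · refine hF.norm.mono' ((hχc n).aestronglyMeasurable.smul hF.1) ?_
      refine Filter.Eventually.of_forall fun x => ?_
      simp only [ContinuousLinearMap.lsmul_apply, norm_smul]
      exact mul_le_of_le_one_left (norm_nonneg _) (hχ1 n x)
    · intro x hx
      apply hd
      rintro rfl
      have : χ n =ᶠ[nhds 0] fun _ => 0 := by
        have h0 : (b : E3 → ℝ) =ᶠ[nhds 0] fun _ => 1 := b.eventuallyEq_one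
        have ht : Filter.Tendsto (fun x : E3 => (n + 1 : ℝ) • x) (nhds 0) (nhds 0) := by
          have : Continuous (fun x : E3 => (n + 1 : ℝ) • x) := by fun_prop
          simpa using this.tendsto 0
        filter_upwards [ht.eventually h0] with y hy
        simp [χ, hy]
      exact (notMem_tsupport_iff_eventuallyEq.2 this) hx
  have hae : ∀ᵐ x : E3, x ≠ 0 := by simp [ae_iff]
  have l1 : Filter.Tendsto (fun n => ∫ x, χ n x • F' x) Filter.atTop (nhds (∫ x, F' x)) := by
    refine tendsto_integral_of_dominated_convergence (fun x => ‖F' x‖)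
      (fun n => (hχc n).aestronglyMeasurable.smul hF'.1) hF'.norm ?_ ?_
    · intro n; refine Filter.Eventually.of_forall fun x => ?_
      rw [norm_smul]
      exact mul_le_of_le_one_left (norm_nonneg _) (hχ1 n x)
    · filter_upwards [hae] with x hx
      refine tendsto_const_nhds.congr' ?_
      filter_upwards [hχ'0 x hx] with n hn
      simp [hn.1]
  have l2 : Filter.Tendsto (fun n => ∫ x, χ' n x • F x) Filter.atTop (nhds (∫ _ : E3, 0)) := by
    refine tendsto_integral_of_dominated_convergence (fun x => 2 * K * ‖v‖ * (‖x‖⁻¹ * ‖F x‖))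
      (fun n => (hχ'c n).aestronglyMeasurable.smul hF.1) (hF1.const_mul _) ?_ ?_
    · intro n; refine Filter.Eventually.of_forall fun x => ?_
      rw [norm_smul, ← mul_assoc]
      gcongr
      exact hχ'b n x
    · filter_upwards [hae] with x hx
      refine tendsto_const_nhds.congr' ?_
      filter_upwards [hχ'0 x hx] with n hn
      simp [hn.2]
  have l3 := l2.neg
  simp only [integral_zero, neg_zero] at l3
  exact tendsto_nhds_unique l1 (l3.congr fun n => (key n).symm)

section
open scoped Pointwise


/-- the affine chart -/
noncomputable def chP (i : Fin 3) (c : ℝ) (b : Fin 2 → ℝ) : E3 :=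
  WithLp.toLp 2 (i.insertNth c b : Fin 3 → ℝ)

/-- the sphere chart -/
noncomputable def chS (i : Fin 3) (c : ℝ) (b : Fin 2 → ℝ) : E3 :=
  ‖chP i c b‖⁻¹ • chP i c b

theorem chP_norm_sq (i : Fin 3) (c : ℝ) (b : Fin 2 → ℝ) :
    ‖chP i c b‖ ^ 2 = c ^ 2 + b 0 ^ 2 + b 1 ^ 2 := by
  rw [EuclideanSpace.norm_sq_eq, Fin.sum_univ_succAbove _ i]
  simp [chP, Fin.sum_univ_two]; ring

theorem chP_dist (i : Fin 3) (c : ℝ) (b b' : Fin 2 → ℝ) :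
    ‖chP i c b - chP i c b'‖ ≤ 2 * ‖b - b'‖ := by
  have h : ‖chP i c b - chP i c b'‖ ^ 2 = (b 0 - b' 0) ^ 2 + (b 1 - b' 1) ^ 2 := by
    rw [EuclideanSpace.norm_sq_eq, Fin.sum_univ_succAbove _ i]
    simp [chP, Fin.sum_univ_two]
  have h0 := norm_le_pi_norm (b - b') 0
  have h1 := norm_le_pi_norm (b - b') 1
  simp only [Pi.sub_apply, Real.norm_eq_abs] at h0 h1
  have h0' := sq_le_sq' (by linarith [abs_nonneg (b 0 - b' 0), abs_nonneg (b 1 - b' 1), norm_nonneg (b - b')]) h0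
  have h1' := sq_le_sq' (by linarith [abs_nonneg (b 0 - b' 0), abs_nonneg (b 1 - b' 1), norm_nonneg (b - b')]) h1
  rw [sq_abs] at h0' h1'
  refine abs_le_of_sq_le_sq' ?_ (by positivity) |>.2
  nlinarith [norm_nonneg (b - b')]

theorem normalize_dist {x y : E3} (hx : 1 ≤ ‖x‖) (hy : 1 ≤ ‖y‖) :
    ‖‖x‖⁻¹ • x - ‖y‖⁻¹ • y‖ ≤ 2 * ‖x - y‖ := by
  have hx0 : 0 < ‖x‖ := by linarith
  have hy0 : 0 < ‖y‖ := by linarith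
  have : ‖x‖⁻¹ • x - ‖y‖⁻¹ • y = ‖x‖⁻¹ • (x - y) + (‖x‖⁻¹ - ‖y‖⁻¹) • y := by
    module
  rw [this]
  refine (norm_add_le _ _).trans ?_
  have h1 : ‖‖x‖⁻¹ • (x - y)‖ ≤ ‖x - y‖ := by
    rw [norm_smul, norm_inv, norm_norm]
    exact mul_le_of_le_one_left (norm_nonneg _) (inv_le_one_of_one_le₀ hx)
  have h2 : ‖(‖x‖⁻¹ - ‖y‖⁻¹) • y‖ ≤ ‖x - y‖ := by
    rw [norm_smul]
    have : (‖x‖⁻¹ - ‖y‖⁻¹) = ‖x‖⁻¹ * ‖y‖⁻¹ * (‖y‖ - ‖x‖) := by field_simp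
    rw [this, norm_mul, norm_mul, norm_inv, norm_inv, norm_norm, norm_norm]
    have h3 : ‖‖y‖ - ‖x‖‖ ≤ ‖x - y‖ := by rw [norm_sub_rev x y]; exact abs_norm_sub_norm_le y x
    calc ‖x‖⁻¹ * ‖y‖⁻¹ * ‖‖y‖ - ‖x‖‖ * ‖y‖ = ‖x‖⁻¹ * ‖‖y‖ - ‖x‖‖ := by field_simp
      _ ≤ 1 * ‖x - y‖ := by
        gcongr
        exact inv_le_one_of_one_le₀ hx
      _ = _ := one_mul _
  linarith

theorem chP_one_le (i : Fin 3) (c : ℝ) (hc : c ^ 2 = 1) (b : Fin 2 → ℝ) : 1 ≤ ‖chP i c b‖ := by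
  have := chP_norm_sq i c b
  nlinarith [norm_nonneg (chP i c b), sq_nonneg (b 0), sq_nonneg (b 1)]

theorem chS_lip (i : Fin 3) (c : ℝ) (hc : c ^ 2 = 1) : LipschitzWith 4 (chS i c) := by
  refine LipschitzWith.of_dist_le_mul fun b b' => ?_
  rw [dist_eq_norm, dist_eq_norm]
  refine (normalize_dist (chP_one_le i c hc b) (chP_one_le i c hc b')).trans ?_
  have := chP_dist i c b b'
  push_cast
  linarith

theorem cone_vol (i : Fin 3) (c : ℝ) (hc : c ^ 2 = 1) (B : Set (Fin 2 → ℝ)) (hB : MeasurableSet B)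
    (hB1 : ∀ b ∈ B, ∀ j, |b j| ≤ 1) (A : Set E3) (hA : ∀ b ∈ B, chS i c b ∈ A) :
    volume B ≤ 64 * volume (Set.Ioo (0 : ℝ) 1 • A) := by
  have hcc : c = 1 ∨ c = -1 := by simpa using hc
  let T : Set (ℝ × (Fin 2 → ℝ)) := {p | c * p.1 ∈ Set.Ioo (1/4 : ℝ) (1/2) ∧ (c * p.1)⁻¹ • p.2 ∈ B}
  have hT : MeasurableSet T := by
    refine MeasurableSet.inter ?_ ?_
    · exact (by fun_prop : Measurable fun p : ℝ × (Fin 2 → ℝ) => c * p.1) measurableSet_Ioo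
    · exact (by fun_prop : Measurable fun p : ℝ × (Fin 2 → ℝ) => (c * p.1)⁻¹ • p.2) hB
  have hTv : (1/64 : ENNReal) * volume B ≤ volume T := by
    rw [Measure.volume_eq_prod, Measure.prod_apply hT]
    let J : Set ℝ := {s | c * s ∈ Set.Ioo (1/4 : ℝ) (1/2)}
    have hJm : MeasurableSet J :=
      (by fun_prop : Measurable fun s : ℝ => c * s) measurableSet_Ioo
    have hJ : volume J = ENNReal.ofReal (1/4) := by
      have : J = (fun s => c * s) ⁻¹' Set.Ioo (1/4 : ℝ) (1/2) := rfl
      rw [this, Real.volume_preimage_mul_left (by rcases hcc with h | h <;> simp [h])]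
      rcases hcc with h | h <;> norm_num [h]
    have : ∀ s, J.indicator (fun _ => (1/16 : ENNReal) * volume B) s ≤ volume (Prod.mk s ⁻¹' T) := by
      intro s
      by_cases hs : s ∈ J
      · rw [Set.indicator_of_mem hs]
        have hs' : c * s ∈ Set.Ioo (1/4 : ℝ) (1/2) := hs
        have hpos : 0 < c * s := by linarith [hs'.1]
        have : Prod.mk s ⁻¹' T = (c * s) • B := by
          ext y
          simp only [Set.mem_preimage, T, Set.mem_ofPred_eq, hs', true_and]
          rw [Set.mem_smul_set_iff_inv_smul_mem₀ hpos.ne']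
        rw [this, Measure.addHaar_smul]
        gcongr
        rw [abs_of_pos (by positivity)]
        have : (1/16 : ENNReal) = ENNReal.ofReal (1/16) := by
          rw [ENNReal.ofReal_div_of_pos (by norm_num)]; simp
        rw [this]
        apply ENNReal.ofReal_le_ofReal
        simp
        nlinarith [hs'.1]
      · rw [Set.indicator_of_notMem hs]; exact zero_le
    refine le_trans ?_ (lintegral_mono this)
    rw [lintegral_indicator hJm, setLIntegral_const, hJ]
    have e1 : ENNReal.ofReal (1/4) = 1/4 := by
      rw [ENNReal.ofReal_div_of_pos (by norm_num)]; simp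
    rw [e1, mul_right_comm]
    gcongr
    apply le_of_eq
    rw [one_div, one_div, one_div, ← ENNReal.mul_inv (by simp) (by simp)]
    norm_num
  have hmp : MeasurePreserving (fun x : E3 => MeasurableEquiv.piFinSuccAbove (fun _ => ℝ) i
      (WithLp.ofLp x)) volume volume := by
    have h1 := volume_preserving_piFinSuccAbove (fun _ : Fin 3 => ℝ) i
    have h2 := EuclideanSpace.volume_preserving_symm_measurableEquiv_toLp (Fin 3)
    exact h1.comp h2
  have hsub : (fun x : E3 => MeasurableEquiv.piFinSuccAbove (fun _ => ℝ) i
      (WithLp.ofLp x)) ⁻¹' T ⊆ Set.Ioo (0 : ℝ) 1 • A := by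
    intro x hx
    obtain ⟨h1, h2⟩ := hx
    simp only [MeasurableEquiv.piFinSuccAbove_apply, Fin.insertNthEquiv, Equiv.coe_fn_symm_mk] at h1 h2
    set t := c * x i with ht
    have htp : 0 < t := by linarith [h1.1]
    set b : Fin 2 → ℝ := t⁻¹ • i.removeNth (WithLp.ofLp x) with hb
    have hx : x = t • chP i c b := by
      ext j
      refine Fin.succAboveCases i ?_ (fun j => ?_) j
      · simp [chP, ht]; linear_combination -(x i) * hc
      · simp [chP, hb, htp.ne', Fin.removeNth]
    have hn : ‖chP i c b‖ ≤ 2 := by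
      have := chP_norm_sq i c b
      have a0 := hB1 b h2 0
      have a1 := hB1 b h2 1
      rw [← sq_le_one_iff_abs_le_one] at a0 a1
      nlinarith
    have hn1 := chP_one_le i c hc b
    rw [Set.mem_smul]
    refine ⟨t * ‖chP i c b‖, ⟨by positivity, ?_⟩, chS i c b, hA b h2, ?_⟩
    · nlinarith [h1.2]
    · rw [chS, smul_smul, mul_assoc, mul_inv_cancel₀ (by positivity), mul_one, ← hx]
  have := (hmp.measure_preimage hT.nullMeasurableSet).symm.le.trans (measure_mono hsub)
  have h4 := hTv.trans this
  calc volume B = 64 * ((1/64) * volume B) := by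
        rw [← mul_assoc, ENNReal.mul_div_cancel (by norm_num) (by norm_num), one_mul]
    _ ≤ _ := by gcongr

theorem sphere_hausdorff_le (s : Set (sphere (0 : E3) 1)) (hs : MeasurableSet s) :
    μH[2] ((↑) '' s : Set E3) ≤ 2048 * (volume : Measure E3).toSphere s := by
  set A : Set E3 := (↑) '' s with hA
  have hAm : MeasurableSet A := (MeasurableEmbedding.subtype_coe
    (isClosed_sphere.measurableSet)).measurableSet_image.2 hs
  let B : Fin 3 → ℝ → Set (Fin 2 → ℝ) := fun i c => {b | (∀ j, |b j| ≤ 1) ∧ chS i c b ∈ A}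
  have hpiece : ∀ i c, c ^ 2 = (1:ℝ) → μH[2] (chS i c '' B i c) ≤
      1024 * volume (Set.Ioo (0 : ℝ) 1 • A) := by
    intro i c hc
    have hBm : MeasurableSet (B i c) := by
      have e : B i c = (⋂ j : Fin 2, {b : Fin 2 → ℝ | |b j| ≤ 1}) ∩ chS i c ⁻¹' A := by
        ext; simp [B]
      rw [e]
      refine MeasurableSet.inter ?_ ((chS_lip i c hc).continuous.measurable hAm)
      exact MeasurableSet.iInter fun j => measurableSet_le (by fun_prop) (by fun_prop)
    have h1 := (chS_lip i c hc).hausdorffMeasure_image_le (d := 2) (by norm_num) (B i c)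
    have h2 := cone_vol i c hc (B i c) hBm (fun b hb => hb.1) A (fun b hb => hb.2)
    have h3 : (μH[2] : Measure (Fin 2 → ℝ)) = volume := by
      have := hausdorffMeasure_pi_real (ι := Fin 2)
      simpa using this
    rw [h3] at h1
    refine h1.trans ?_
    calc _ ≤ ((4 : NNReal) : ENNReal) ^ (2:ℝ) * (64 * volume (Set.Ioo (0 : ℝ) 1 • A)) := by gcongr
      _ = _ := by rw [← mul_assoc]; congr 1; norm_num
  have hcov : A ⊆ ⋃ i : Fin 3, (chS i 1 '' B i 1 ∪ chS i (-1) '' B i (-1)) := by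
    intro x hx
    have hx1 : ‖x‖ = 1 := by
      obtain ⟨y, _, rfl⟩ := hx; simpa using y.2
    obtain ⟨i, -, hi⟩ := Finset.exists_max_image Finset.univ (fun j : Fin 3 => |x j|) ⟨0, by simp⟩
    have hxi : x i ≠ 0 := by
      intro h
      have : x = 0 := by
        ext j
        have := hi j (by simp)
        simpa [h] using this
      simp [this] at hx1
    have hp : 0 < |x i| := abs_pos.2 hxi
    have gen : ∀ c : ℝ, c ^ 2 = 1 → x i = c * |x i| → x ∈ chS i c '' B i c := by
      intro c hc hci
      set b : Fin 2 → ℝ := |x i|⁻¹ • i.removeNth (WithLp.ofLp x) with hb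
      have hPb : chP i c b = |x i|⁻¹ • x := by
        ext j
        refine Fin.succAboveCases i ?_ (fun j => ?_) j
        · simp [chP]; rw [eq_inv_mul_iff_mul_eq₀ hp.ne']; linarith
        · simp [chP, hb, Fin.removeNth]
      have hS : chS i c b = x := by
        rw [chS, hPb, norm_smul, hx1, norm_inv, Real.norm_of_nonneg hp.le, smul_smul]
        simp [hp.ne']
      refine ⟨b, ⟨fun j => ?_, hS ▸ hx⟩, hS⟩
      simp only [hb, Pi.smul_apply, smul_eq_mul, Fin.removeNth, abs_mul, abs_inv, abs_abs]
      rw [inv_mul_le_iff₀ hp, mul_one]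
      exact hi _ (by simp)
    refine Set.mem_iUnion.2 ⟨i, ?_⟩
    rcases lt_or_gt_of_ne hxi with h | h
    · exact Or.inr (gen _ (by norm_num) (by rw [abs_of_neg h]; ring))
    · exact Or.inl (gen _ (by norm_num) (by rw [abs_of_pos h]; ring))
  rw [Measure.toSphere_apply' _ hs]
  calc μH[2] A ≤ μH[2] (⋃ i : Fin 3, (chS i 1 '' B i 1 ∪ chS i (-1) '' B i (-1))) :=
        measure_mono hcov
    _ ≤ ∑ i : Fin 3, (μH[2] (chS i 1 '' B i 1) + μH[2] (chS i (-1) '' B i (-1))) := by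
        refine (measure_iUnion_fintype_le _ _).trans ?_
        gcongr
        exact measure_union_le _ _
    _ ≤ ∑ i : Fin 3, (1024 * volume (Set.Ioo (0 : ℝ) 1 • A) + 1024 * volume (Set.Ioo (0 : ℝ) 1 • A)) := by
        gcongr
        · exact hpiece _ _ (by norm_num)
        · exact hpiece _ _ (by norm_num)
    _ = _ := by
        simp only [Finset.sum_const, Finset.card_univ, Fintype.card_fin, finrank_euclideanSpace]
        rw [← add_mul, nsmul_eq_mul, ← mul_assoc, ← mul_assoc]
        congr 1
        norm_num

theorem sphere_lintegral_le (h : E3 → ENNReal) :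
    ∫⁻ x in sphere (0 : E3) 1, h x ∂μH[2] ≤
      2048 * ∫⁻ s : sphere (0 : E3) 1, h s ∂(volume : Measure E3).toSphere := by
  have he : MeasurableEmbedding (Subtype.val : sphere (0 : E3) 1 → E3) :=
    MeasurableEmbedding.subtype_coe isClosed_sphere.measurableSet
  rw [← lintegral_subtype_comap isClosed_sphere.measurableSet]
  have hle : Measure.comap Subtype.val (μH[2] : Measure E3) ≤
      (2048 : ENNReal) • (volume : Measure E3).toSphere := by
    refine Measure.le_iff.2 fun s hs => ?_
    rw [he.comap_apply]
    exact sphere_hausdorff_le s hs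
  refine (lintegral_mono' hle le_rfl).trans ?_
  rw [lintegral_smul_measure]
  rfl

end

/-- standard basis vector -/
noncomputable abbrev ee (i : Fin 3) : E3 := EuclideanSpace.single i (1 : ℝ)

/-- partial derivative -/
noncomputable def pd (i : Fin 3) (h : E3 → ℂ) (x : E3) : ℂ := fderiv ℝ h x (ee i)

/-- Helmholtz fundamental solution -/
noncomputable def GG (k : ℂ) (y : E3) : ℂ :=
  Complex.exp (Complex.I * k * (‖y‖ : ℂ)) / (4 * Real.pi * (‖y‖ : ℂ))

theorem fderiv_eq_sum_pd (h : E3 → ℂ) (x v : E3) :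
    fderiv ℝ h x v = ∑ i, (v i : ℂ) * pd i h x := by
  have hv : v = ∑ i, v i • ee i := by
    ext j; simp [Pi.single_apply]
  conv_lhs => rw [hv]
  rw [map_sum]
  simp [pd]

theorem norm_line (x : E3) (hx : x ≠ 0) (i : Fin 3) :
    HasLineDerivAt ℝ (fun y : E3 => ‖y‖) (x i / ‖x‖) x (ee i) := by
  have hxp : 0 < ‖x‖ := norm_pos_iff.2 hx
  have h1 := (hasStrictFDerivAt_norm_sq x).hasFDerivAt.sqrt (by positivity)
  have h2 := h1.hasLineDerivAt (ee i)
  simp only [Real.sqrt_sq (norm_nonneg _)] at h2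
  convert! h2 using 1
  simp
  field_simp
  simp [EuclideanSpace.inner_single_right]

theorem radial_line (W : ℝ → ℂ) (W' : ℂ) (x : E3) (hx : x ≠ 0) (hW : HasDerivAt W W' ‖x‖) (i : Fin 3) :
    HasLineDerivAt ℝ (fun y : E3 => W ‖y‖) (W' * ((x i : ℂ) / (‖x‖ : ℂ))) x (ee i) := by
  have h1 := norm_line x hx i
  unfold HasLineDerivAt at h1 ⊢
  have h2 : HasDerivAt W W' ((fun t : ℝ => ‖x + t • ee i‖) 0) := by simpa using hW
  have h3 := HasDerivAt.scomp (0 : ℝ) h2 h1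
  convert! h3 using 1
  simp [Complex.real_smul]; ring

theorem dom_integrable (lam : ℝ) (hl : 0 < lam) :
    Integrable (fun x : E3 => (1 + (‖x‖ ^ 2)⁻¹) * Real.exp (-lam * ‖x‖)) := by
  rw [integrable_fun_norm_addHaar (volume : Measure E3)
    (f := fun r : ℝ => (1 + (r ^ 2)⁻¹) * Real.exp (-lam * r))]
  have h1 := integrableOn_rpow_mul_exp_neg_mul_rpow (s := 2) (p := 1) (b := lam)
    (by norm_num) (by norm_num) hl
  have h2 := integrableOn_rpow_mul_exp_neg_mul_rpow (s := 0) (p := 1) (b := lam)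
    (by norm_num) (by norm_num) hl
  refine (h1.add h2).congr_fun ?_ measurableSet_Ioi
  intro r hr
  have hr : (0:ℝ) < r := hr
  simp
  field_simp

theorem cs_bound {F : Type*} [NormedAddCommGroup F] [NormedSpace ℝ F] (h : E3 → F) (hc : Continuous h)
    (hs : HasCompactSupport h) (a : ℝ) :
    ∃ K : ℝ, 0 ≤ K ∧ ∀ x, ‖h x‖ ≤ K * Real.exp (-a * ‖x‖) := by
  have h1 : HasCompactSupport (fun x => Real.exp (a * ‖x‖) • h x) := hs.smul_left
  obtain ⟨K, hK⟩ := h1.exists_bound_of_continuous (by fun_prop)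
  refine ⟨K, (norm_nonneg _).trans (hK 0), fun x => ?_⟩
  have := hK x
  rw [norm_smul, Real.norm_of_nonneg (Real.exp_pos _).le] at this
  rw [neg_mul, Real.exp_neg, ← div_eq_mul_inv, le_div_iff₀ (Real.exp_pos _), mul_comm]
  exact this

theorem norm_exp_ik (k : ℂ) (r : ℝ) : ‖Complex.exp (Complex.I * k * (r : ℂ))‖ = Real.exp (-k.im * r) := by
  rw [Complex.norm_exp]; simp

theorem GG_norm_le (k : ℂ) (hk : 0 < k.im) (y : E3) : ‖GG k y‖ ≤ ‖y‖⁻¹ := by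
  rw [GG, norm_div, norm_exp_ik]
  rcases eq_or_ne y 0 with rfl | hy
  · simp
  have hyp : 0 < ‖y‖ := norm_pos_iff.2 hy
  have : ‖(4 * Real.pi * (‖y‖ : ℂ) : ℂ)‖ = 4 * Real.pi * ‖y‖ := by
    simp [abs_of_pos Real.pi_pos]
  rw [this, div_le_iff₀ (by positivity)]
  have h1 : Real.exp (-k.im * ‖y‖) ≤ 1 := Real.exp_le_one_iff.2 (by nlinarith)
  have : ‖y‖⁻¹ * (4 * Real.pi * ‖y‖) = 4 * Real.pi := by field_simp
  rw [this]; linarith [Real.pi_gt_three]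

theorem GG_meas (k : ℂ) : Measurable (GG k) := by
  unfold GG; fun_prop

theorem pd_contDiff {n : ℕ} (i : Fin 3) (h : E3 → ℂ) (hh : ContDiff ℝ (n + 1 : ℕ) h) :
    ContDiff ℝ n (pd i h) := by
  have : ContDiff ℝ n (fderiv ℝ h) := hh.fderiv_right (by push_cast; rfl)
  exact this.clm_apply contDiff_const

theorem pd_cs (i : Fin 3) (h : E3 → ℂ) (hh : HasCompactSupport h) : HasCompactSupport (pd i h) := by
  have := hh.fderiv ℝ
  exact this.comp_left (g := fun L : E3 →L[ℝ] ℂ => L (ee i)) rfl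

theorem pd_line (i : Fin 3) (h : E3 → ℂ) (x : E3) (hh : DifferentiableAt ℝ h x) :
    HasLineDerivAt ℝ h (pd i h x) x (ee i) := hh.hasFDerivAt.hasLineDerivAt _

theorem inv_le_dom (x : ℝ) (hx : 0 ≤ x) : x⁻¹ ≤ 1 + (x ^ 2)⁻¹ := by
  have : (x^2)⁻¹ = x⁻¹ ^ 2 := by rw [inv_pow]
  rw [this]; nlinarith [sq_nonneg (x⁻¹ - 1), inv_nonneg.2 hx]

theorem sphere_mass : (volume : Measure E3).toSphere.real Set.univ = 4 * Real.pi := by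
  rw [Measure.toSphere_real_apply_univ, Measure.real, EuclideanSpace.volume_ball_fin_three]
  simp only [ENNReal.toReal_mul, finrank_euclideanSpace, Fintype.card_fin]
  rw [← ENNReal.ofReal_pow (by norm_num), ENNReal.toReal_ofReal (by positivity), ENNReal.toReal_ofReal (by positivity)]
  push_cast; ring

theorem fund_sol (k : ℂ) (hk : 0 < k.im) (h : E3 → ℂ) (hh : ContDiff ℝ 2 h)
    (hs : HasCompactSupport h) :
    ∫ y, GG k y * ((∑ i, pd i (pd i h) y) + k ^ 2 * h y) = - h 0 := by
  have hpd : ∀ i, ContDiff ℝ 1 (pd i h) := fun i => pd_contDiff (n := 1) i h (by exact_mod_cast hh)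
  have hpd2 : ∀ i, ContDiff ℝ 0 (pd i (pd i h)) := fun i =>
    pd_contDiff (n := 0) i _ (by simpa using hpd i)
  obtain ⟨K0, hK0, hb0⟩ := cs_bound h hh.continuous hs 1
  choose K1 hK1 hb1 using fun i => cs_bound (pd i h) (hpd i).continuous (pd_cs i h hs) 1
  choose K2 hK2 hb2 using fun i => cs_bound (pd i (pd i h)) (hpd2 i).continuous
    (pd_cs i _ (pd_cs i h hs)) 1
  let g : ℝ → ℂ := fun r => Complex.exp (Complex.I * k * (r : ℂ)) / (4 * Real.pi * (r : ℂ))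
  let g' : ℝ → ℂ := fun r => (Complex.I * k * r - 1) * Complex.exp (Complex.I * k * (r : ℂ)) /
    (4 * Real.pi * (r : ℂ) ^ 2)
  have hpi : (Real.pi : ℂ) ≠ 0 := by exact_mod_cast Real.pi_ne_zero
  have hE : ∀ r : ℝ, HasDerivAt (fun r : ℝ => Complex.exp (Complex.I * k * (r : ℂ)))
      (Complex.I * k * Complex.exp (Complex.I * k * (r : ℂ))) r := by
    intro r
    have := (((hasDerivAt_id r).ofReal_comp).const_mul (Complex.I * k)).cexp
    convert! this using 1
    simp; ring
  have hg : ∀ r : ℝ, r ≠ 0 → HasDerivAt g (g' r) r := by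
    intro r hr
    have hr' : (r : ℂ) ≠ 0 := by exact_mod_cast hr
    have h2 := ((hasDerivAt_id r).ofReal_comp).const_mul (4 * Real.pi : ℂ)
    have := (hE r).div h2 (by simp [hr, hpi])
    convert! this using 1
    simp [g']; field_simp
  have hg'm : Measurable g' := by simp only [g']; fun_prop
  -- bounds
  have hdom := dom_integrable 1 one_pos
  have hgb : ∀ x : E3, ‖g' ‖x‖‖ ≤ (‖k‖ + 1) * (1 + (‖x‖ ^ 2)⁻¹) := by
    intro x
    rcases eq_or_ne x 0 with rfl | hx
    · simp [g']; positivity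
    have hxp : 0 < ‖x‖ := norm_pos_iff.2 hx
    simp only [g']
    rw [norm_div, norm_mul, norm_exp_ik]
    have e1 : ‖(4 * Real.pi * (‖x‖ : ℂ) ^ 2 : ℂ)‖ = 4 * Real.pi * ‖x‖ ^ 2 := by
      simp [abs_of_pos Real.pi_pos]
    have e2 : ‖Complex.I * k * (‖x‖ : ℂ) - 1‖ ≤ ‖k‖ * ‖x‖ + 1 := by
      refine (norm_sub_le _ _).trans ?_
      simp
    have h1 : Real.exp (-k.im * ‖x‖) ≤ 1 := Real.exp_le_one_iff.2 (by nlinarith)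
    rw [e1, div_le_iff₀ (by positivity)]
    have e3 : (‖k‖ + 1) * (1 + (‖x‖ ^ 2)⁻¹) * (4 * Real.pi * ‖x‖ ^ 2) =
      (‖k‖ + 1) * (1 + ‖x‖ ^ 2) * (4 * Real.pi) := by field_simp; ring
    rw [e3]
    calc _ ≤ (‖k‖ * ‖x‖ + 1) * 1 := by gcongr
      _ ≤ (‖k‖ + 1) * (1 + ‖x‖ ^ 2) * 1 := by
        nlinarith [norm_nonneg k, sq_nonneg (‖x‖ - 1), mul_nonneg (norm_nonneg k) (sq_nonneg (‖x‖ - 1)), mul_nonneg (norm_nonneg k) (sq_nonneg ‖x‖)]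
      _ ≤ _ := by gcongr; linarith [Real.pi_gt_three]
  have hGb : ∀ x : E3, ‖GG k x‖ ≤ 1 + (‖x‖ ^ 2)⁻¹ := fun x =>
    (GG_norm_le k hk x).trans (inv_le_dom _ (norm_nonneg _))
  have hmul : ∀ (a : E3 → ℂ) (b : E3 → ℂ) (A B : ℝ), 0 ≤ A → 0 ≤ B → Measurable a → Continuous b →
      (∀ x, ‖a x‖ ≤ A * (1 + (‖x‖ ^ 2)⁻¹)) → (∀ x, ‖b x‖ ≤ B * Real.exp (-1 * ‖x‖)) →
      Integrable (fun x => a x * b x) := by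
    intro a b A B hA hB ha hb hab hbb
    refine (hdom.const_mul (A * B)).mono' (ha.mul hb.measurable).aestronglyMeasurable ?_
    refine Filter.Eventually.of_forall fun x => ?_
    rw [norm_mul]
    calc _ ≤ (A * (1 + (‖x‖ ^ 2)⁻¹)) * (B * Real.exp (-1 * ‖x‖)) := by
          gcongr
          · exact hab x
          · exact hbb x
      _ = _ := by ring
  have hxi : ∀ (x : E3) i, ‖((x i : ℂ) / (‖x‖ : ℂ))‖ ≤ 1 := by
    intro x i
    rw [norm_div, Complex.norm_real, Complex.norm_real, norm_norm]
    exact div_le_one_of_le₀ (PiLp.norm_apply_le x i) (norm_nonneg _)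
  have hI1 : ∀ i, Integrable (fun x : E3 => (g' ‖x‖ * ((x i : ℂ) / (‖x‖ : ℂ))) * pd i h x) := by
    intro i
    refine hmul _ _ (‖k‖ + 1) (K1 i) (by positivity) (hK1 i) (by fun_prop) (hpd i).continuous ?_ (hb1 i)
    intro x
    rw [norm_mul]
    calc _ ≤ ((‖k‖ + 1) * (1 + (‖x‖ ^ 2)⁻¹)) * 1 := by
          gcongr
          · exact hgb x
          · exact hxi x i
      _ = _ := by ring
  have hI2 : ∀ i, Integrable (fun x : E3 => GG k x * pd i (pd i h) x) := fun i =>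
    hmul _ _ 1 (K2 i) (by positivity) (hK2 i) (GG_meas k) (hpd2 i).continuous
      (fun x => by simpa using hGb x) (hb2 i)
  have hI3 : ∀ i, Integrable (fun x : E3 => GG k x * pd i h x) := fun i =>
    hmul _ _ 1 (K1 i) (by positivity) (hK1 i) (GG_meas k) (hpd i).continuous
      (fun x => by simpa using hGb x) (hb1 i)
  have hI4 : Integrable (fun x : E3 => GG k x * h x) :=
    hmul _ _ 1 K0 (by positivity) hK0 (GG_meas k) hh.continuous
      (fun x => by simpa using hGb x) hb0
  have hibp : ∀ i, ∫ x : E3, ((g' ‖x‖ * ((x i : ℂ) / (‖x‖ : ℂ))) * pd i h x +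
      GG k x * pd i (pd i h) x) = 0 := by
    intro i
    refine ibp0 (fun x => GG k x * pd i h x) _ (ee i) ?_ (hI3 i) ?_ ((hI1 i).add (hI2 i))
    · intro x hx
      have h1 := radial_line g (g' ‖x‖) x hx (hg _ (norm_ne_zero_iff.2 hx)) i
      have h2 := pd_line i (pd i h) x ((hpd i).differentiable (by norm_num) x)
      unfold HasLineDerivAt at h1 h2 ⊢
      have h3 := h1.mul h2
      simp only [zero_smul, add_zero] at h3
      exact h3
    · have := hmul (fun x => (‖x‖ : ℂ)⁻¹ * GG k x) (pd i h) 1 (K1 i) (by positivity) (hK1 i)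
        ((by fun_prop : Measurable fun x : E3 => (‖x‖ : ℂ)⁻¹).mul (GG_meas k)) (hpd i).continuous ?_ (hb1 i)
      · refine this.norm.congr (Filter.Eventually.of_forall fun x => ?_)
        simp [mul_assoc]
      · intro x
        rw [norm_mul, norm_inv, Complex.norm_real, norm_norm, one_mul]
        calc _ ≤ ‖x‖⁻¹ * ‖x‖⁻¹ := by gcongr; exact GG_norm_le k hk x
          _ = (‖x‖ ^ 2)⁻¹ := by rw [sq, mul_inv]
          _ ≤ _ := by linarith
  let Φ : E3 → ℂ := fun x => (∑ i, (g' ‖x‖ * ((x i : ℂ) / (‖x‖ : ℂ))) * pd i h x) - k ^ 2 * (GG k x * h x)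
  have hΦi : Integrable Φ := (integrable_finsetSum _ fun i _ => hI1 i).sub (hI4.const_mul _)
  have hsum : ∫ y, GG k y * ((∑ i, pd i (pd i h) y) + k ^ 2 * h y) = - ∫ y, Φ y := by
    have e : ∀ y, GG k y * ((∑ i, pd i (pd i h) y) + k ^ 2 * h y) =
      (∑ i, ((g' ‖y‖ * ((y i : ℂ) / (‖y‖ : ℂ))) * pd i h y + GG k y * pd i (pd i h) y)) - Φ y := by
      intro y
      simp only [Φ, Finset.sum_add_distrib, mul_add, Finset.mul_sum]
      ring
    have hI12 : ∀ i, Integrable (fun x : E3 => (g' ‖x‖ * ((x i : ℂ) / (‖x‖ : ℂ))) * pd i h x +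
        GG k x * pd i (pd i h) x) := fun i => (hI1 i).add (hI2 i)
    rw [integral_congr_ae (Filter.Eventually.of_forall e), integral_sub
      (integrable_finsetSum _ fun i _ => hI12 i) hΦi,
      integral_finsetSum _ fun i _ => hI12 i]
    simp [hibp]
  rw [hsum, polar_integral Φ hΦi, neg_inj]
  have inner : ∀ s : sphere (0 : E3) 1, ∫ r in Set.Ioi (0 : ℝ), ((r : ℂ) ^ 2) * Φ (r • (s : E3)) =
      h 0 / (4 * Real.pi) := by
    intro s
    have hs1 : ‖(s : E3)‖ = 1 := by simp
    let q : ℝ → ℂ := fun r => (Complex.I * k * r - 1) * Complex.exp (Complex.I * k * (r : ℂ)) / (4 * Real.pi)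
    let p : ℝ → ℂ := fun r => q r * h (r • (s : E3))
    have hq : ContDiff ℝ 1 q := by
      have : ContDiff ℝ 1 (fun r : ℝ => (r : ℂ)) := Complex.ofRealCLM.contDiff
      simp only [q]; fun_prop
    have hhs : ContDiff ℝ 1 (fun r : ℝ => h (r • (s : E3))) := by
      have : ContDiff ℝ 1 h := hh.of_le (by norm_num)
      fun_prop
    have hp : ContDiff ℝ 1 p := hq.mul hhs
    have hpc : HasCompactSupport p := by
      obtain ⟨R, hR⟩ := hs.isCompact.isBounded.subset_closedBall (0 : E3)
      refine HasCompactSupport.intro (isCompact_Icc (a := -R) (b := R)) fun r hr => ?_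
      have : r • (s : E3) ∉ tsupport h := by
        intro hm
        have := hR hm
        simp [norm_smul, hs1] at this
        exact hr (abs_le.1 this)
      simp [p, image_eq_zero_of_notMem_tsupport this]
    have hder : ∀ r : ℝ, 0 < r → HasDerivAt p (((r : ℂ) ^ 2) * Φ (r • (s : E3))) r := by
      intro r hr
      have hr' : (r : ℂ) ≠ 0 := by exact_mod_cast hr.ne'
      have d1 : HasDerivAt q (-k ^ 2 * r * Complex.exp (Complex.I * k * (r : ℂ)) / (4 * Real.pi)) r := by
        have a1 := (((hasDerivAt_id r).ofReal_comp).const_mul (Complex.I * k)).sub_const 1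
        have := (a1.mul (hE r)).div_const (4 * Real.pi : ℂ)
        convert! this using 1
        simp
        ring_nf
        simp
      have d2 : HasDerivAt (fun r : ℝ => h (r • (s : E3))) (fderiv ℝ h (r • (s : E3)) s) r := by
        have b1 : HasDerivAt (fun r : ℝ => r • (s : E3)) (s : E3) r := by
          simpa using (hasDerivAt_id r).smul_const (s : E3)
        exact ((hh.differentiable (by norm_num) (r • (s : E3))).hasFDerivAt.comp_hasDerivAt r b1)
      have := d1.mul d2
      convert! this using 1
      rw [fderiv_eq_sum_pd]
      have hn : ‖r • (s : E3)‖ = r := by rw [norm_smul, hs1, Real.norm_of_nonneg hr.le, mul_one]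
      simp only [Φ, hn, g', GG, q, PiLp.smul_apply, smul_eq_mul, Complex.ofReal_mul, mul_sub, Finset.mul_sum]
      rw [sub_eq_add_neg, add_comm]
      congr 1
      · field_simp
      · refine Finset.sum_congr rfl fun i _ => ?_
        field_simp
    have hint : IntegrableOn (fun r : ℝ => ((r : ℂ) ^ 2) * Φ (r • (s : E3))) (Set.Ioi 0) := by
      have : Integrable (deriv p) := (hp.continuous_deriv (by norm_num)).integrable_of_hasCompactSupport hpc.deriv
      refine this.integrableOn.congr_fun ?_ measurableSet_Ioi
      intro r hr
      exact (hder r hr).deriv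
    have := integral_Ioi_of_hasDerivAt_of_tendsto (f := p) (m := 0) hp.continuous.continuousWithinAt
      (fun r hr => hder r hr) hint ?_
    · rw [this]; simp [p, q]; ring
    · have := hpc.is_zero_at_infty
      exact this.mono_left atTop_le_cocompact 
  simp only [inner, integral_const, sphere_mass]
  rw [Complex.real_smul]
  push_cast
  field_simp

theorem GG_norm_le2 (k : ℂ) (y : E3) : ‖GG k y‖ ≤ ‖y‖⁻¹ * Real.exp (-k.im * ‖y‖) := by
  rw [GG, norm_div, norm_exp_ik]
  rcases eq_or_ne y 0 with rfl | hy
  · simp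
  have hyp : 0 < ‖y‖ := norm_pos_iff.2 hy
  have : ‖(4 * Real.pi * (‖y‖ : ℂ) : ℂ)‖ = 4 * Real.pi * ‖y‖ := by
    simp [abs_of_pos Real.pi_pos]
  rw [this, div_le_iff₀ (by positivity)]
  have : ‖y‖⁻¹ * Real.exp (-k.im * ‖y‖) * (4 * Real.pi * ‖y‖) = 4 * Real.pi * Real.exp (-k.im * ‖y‖) := by field_simp
  rw [this]; nlinarith [Real.pi_gt_three, Real.exp_pos (-k.im * ‖y‖)]

theorem GG_integrable (k : ℂ) (hk : 0 < k.im) : Integrable (GG k) := by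
  refine (dom_integrable k.im hk).mono' (GG_meas k).aestronglyMeasurable ?_
  refine Filter.Eventually.of_forall fun x => (GG_norm_le2 k x).trans ?_
  gcongr
  exact inv_le_dom _ (norm_nonneg _)

/-- convolution with the fundamental solution -/
noncomputable def cv (k : ℂ) (h : E3 → ℂ) (x : E3) : ℂ := ∫ y, GG k y * h (x - y)

theorem cv_eq_conv (k : ℂ) (h : E3 → ℂ) :
    cv k h = convolution (GG k) h (ContinuousLinearMap.mul ℝ ℂ) volume := by
  ext x; simp [cv, convolution]

theorem cv_contDiff (k : ℂ) (hk : 0 < k.im) {n : ℕ∞} (h : E3 → ℂ) (hh : ContDiff ℝ n h)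
    (hs : HasCompactSupport h) : ContDiff ℝ n (cv k h) := by
  rw [cv_eq_conv]
  exact hs.contDiff_convolution_right _ (GG_integrable k hk).locallyIntegrable hh

theorem cv_pd (k : ℂ) (hk : 0 < k.im) (h : E3 → ℂ) (hh : ContDiff ℝ 1 h)
    (hs : HasCompactSupport h) (i : Fin 3) : pd i (cv k h) = cv k (pd i h) := by
  ext x
  have h1 := hs.hasFDerivAt_convolution_right (ContinuousLinearMap.mul ℝ ℂ)
    (GG_integrable k hk).locallyIntegrable hh x
  rw [← cv_eq_conv] at h1
  rw [pd, h1.fderiv, convolution_precompR_apply _ (GG_integrable k hk).locallyIntegrable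
    (hs.fderiv ℝ) (hh.continuous_fderiv (by norm_num))]
  simp [cv, convolution, pd]

theorem cv_bound (k : ℂ) (hk : 0 < k.im) (h : E3 → ℂ) (hc : Continuous h)
    (hs : HasCompactSupport h) : ∃ K : ℝ, 0 ≤ K ∧ ∀ x, ‖cv k h x‖ ≤ K * Real.exp (-k.im * ‖x‖) := by
  obtain ⟨K, hK, hb⟩ := cs_bound h hc hs (k.im + 1)
  have hd := dom_integrable 1 one_pos
  let φ : E3 → ℝ := fun z => Real.exp (-1 * ‖z‖)
  let d : E3 → ℝ := fun x : E3 => (1 + (‖x‖ ^ 2)⁻¹) * Real.exp (-1 * ‖x‖)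
  have hd : Integrable d := dom_integrable 1 one_pos
  have hφ : Integrable φ := by
    refine hd.mono' (by fun_prop) (Filter.Eventually.of_forall fun x => ?_)
    rw [Real.norm_of_nonneg (Real.exp_pos _).le]
    simp only [φ, d]
    have : 0 ≤ (‖x‖ ^ 2)⁻¹ * Real.exp (-1 * ‖x‖) := by positivity
    linarith
  have hd0 : ∀ x, 0 ≤ d x := fun x => by simp only [d]; positivity
  refine ⟨K * ((∫ z, φ z) + Real.exp 1 * ∫ z, d z), ?_, fun x => ?_⟩
  · have : 0 ≤ ∫ z, φ z := integral_nonneg fun z => (Real.exp_pos _).le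
    have : 0 ≤ ∫ z, d z := integral_nonneg hd0
    positivity
  have hφx : Integrable (fun y => φ (x - y)) := hφ.comp_sub_left x
  have key : ∀ y, ‖GG k y * h (x - y)‖ ≤ (K * Real.exp (-k.im * ‖x‖)) * (φ (x - y) + Real.exp 1 * d y) := by
    intro y
    rw [norm_mul]
    have e1 : ‖y‖⁻¹ * φ (x - y) ≤ φ (x - y) + Real.exp 1 * d y := by
      have p1 : 0 < φ (x - y) := Real.exp_pos _
      have p2 : φ (x - y) ≤ 1 := Real.exp_le_one_iff.2 (by nlinarith [norm_nonneg (x-y)])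
      rcases le_or_gt 1 ‖y‖ with hy | hy
      · have : ‖y‖⁻¹ ≤ 1 := inv_le_one_of_one_le₀ hy
        have := mul_le_mul_of_nonneg_right this p1.le
        have := mul_nonneg (Real.exp_pos 1).le (hd0 y)
        linarith
      · have : Real.exp 1 * d y = (1 + (‖y‖ ^ 2)⁻¹) * Real.exp (1 - ‖y‖) := by
          simp only [d]; rw [mul_left_comm, ← Real.exp_add]; ring_nf
        have h2 : 1 ≤ Real.exp (1 - ‖y‖) := Real.one_le_exp (by linarith)
        have h3 := inv_le_dom ‖y‖ (norm_nonneg _)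
        have h4 : ‖y‖⁻¹ * φ (x - y) ≤ ‖y‖⁻¹ * 1 := by gcongr
        have h5 : (1 + (‖y‖ ^ 2)⁻¹) * 1 ≤ (1 + (‖y‖ ^ 2)⁻¹) * Real.exp (1 - ‖y‖) := by gcongr
        linarith
    calc _ ≤ (‖y‖⁻¹ * Real.exp (-k.im * ‖y‖)) * (K * Real.exp (-(k.im + 1) * ‖x - y‖)) := by
          gcongr
          · exact GG_norm_le2 k y
          · exact hb _
      _ = K * Real.exp (-k.im * ‖y‖ - k.im * ‖x - y‖) * (‖y‖⁻¹ * φ (x - y)) := by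
          have : -(k.im + 1) * ‖x - y‖ = -k.im * ‖x - y‖ + -1 * ‖x - y‖ := by ring
          rw [this, Real.exp_add, sub_eq_add_neg (-k.im * ‖y‖), Real.exp_add]
          simp only [φ, neg_mul]; ring
      _ ≤ _ := by
          gcongr
          have := norm_sub_le_norm_add x y
          have : ‖x‖ ≤ ‖x - y‖ + ‖y‖ := by simpa using norm_add_le (x - y) y
          nlinarith
  have hdi : Integrable (fun y => φ (x - y) + Real.exp 1 * d y) := hφx.add (hd.const_mul _)
  calc ‖cv k h x‖ ≤ ∫ y, ‖GG k y * h (x - y)‖ := norm_integral_le_integral_norm _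
    _ ≤ ∫ y, (K * Real.exp (-k.im * ‖x‖)) * (φ (x - y) + Real.exp 1 * d y) := by
        refine integral_mono_of_nonneg (Filter.Eventually.of_forall fun _ => norm_nonneg _) (hdi.const_mul _)
          (Filter.Eventually.of_forall key)
    _ = _ := by
        rw [integral_const_mul, integral_add hφx (hd.const_mul _), integral_const_mul,
          integral_sub_left_eq_self φ]
        ring

theorem pd_refl (x : E3) (h : E3 → ℂ) (hh : Differentiable ℝ h) (i : Fin 3) :
    pd i (fun y => h (x - y)) = fun y => - pd i h (x - y) := by
  ext y
  have h1 : HasFDerivAt (fun y : E3 => x - y) (-(ContinuousLinearMap.id ℝ E3)) y := (hasFDerivAt_id y).const_sub x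
  have := (hh (x - y)).hasFDerivAt.comp y h1
  rw [pd, pd]
  rw [show (fun y => h (x - y)) = h ∘ (fun y => x - y) from rfl, this.fderiv]
  simp

theorem pd_neg (h : E3 → ℂ) (i : Fin 3) : pd i (fun y => - h y) = fun y => - pd i h y := by
  ext y; simp [pd]

theorem cv_helm (k : ℂ) (hk : 0 < k.im) (h : E3 → ℂ) (hh : ContDiff ℝ 2 h)
    (hs : HasCompactSupport h) (x : E3) :
    (∑ i, pd i (pd i (cv k h)) x) + k ^ 2 * cv k h x = - h x := by
  have hpd : ∀ i, ContDiff ℝ 1 (pd i h) := fun i => pd_contDiff (n := 1) i h (by exact_mod_cast hh)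
  have hpd2 : ∀ i, Continuous (pd i (pd i h)) := fun i =>
    (pd_contDiff (n := 0) i _ (by simpa using hpd i)).continuous
  have hsx : HasCompactSupport (fun y => h (x - y)) := by
    have := hs.comp_homeomorph (Homeomorph.subLeft x)
    exact this
  have h1 := fund_sol k hk (fun y => h (x - y)) (by fun_prop) hsx
  simp only [sub_zero] at h1
  rw [← h1]
  have hint : ∀ (q : E3 → ℂ), Continuous q → HasCompactSupport q → Integrable (fun y => GG k y * q (x - y)) := by
    intro q hq hqs
    obtain ⟨K, hK⟩ := hqs.exists_bound_of_continuous hq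
    exact (GG_integrable k hk).mul_bdd (c := K) (by fun_prop) (Filter.Eventually.of_forall fun y => hK _)
  have e : ∀ y, GG k y * ((∑ i, pd i (pd i fun y => h (x - y)) y) + k ^ 2 * h (x - y)) =
      (∑ i, GG k y * pd i (pd i h) (x - y)) + k ^ 2 * (GG k y * h (x - y)) := by
    intro y
    have : ∀ i, pd i (pd i fun y => h (x - y)) y = pd i (pd i h) (x - y) := by
      intro i
      rw [pd_refl x h (hh.differentiable (by norm_num)), pd_neg, pd_refl x _ ((hpd i).differentiable (by norm_num))]; simp
    simp only [this, mul_add, Finset.mul_sum]; ring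
  rw [integral_congr_ae (Filter.Eventually.of_forall e), integral_add
    (integrable_finsetSum _ fun i _ => hint _ (hpd2 i) (pd_cs i _ (pd_cs i h hs)))
    ((hint _ hh.continuous hs).const_mul _), integral_finsetSum _ fun i _ => hint _ (hpd2 i) (pd_cs i _ (pd_cs i h hs)),
    integral_const_mul]
  congr 1
  refine Finset.sum_congr rfl fun i _ => ?_
  rw [cv_pd k hk h (hh.of_le (by norm_num)) hs, cv_pd k hk _ (hpd i) (pd_cs i h hs)]
  rfl

/-- The source term. -/
noncomputable def src (k : ℂ) (f : E3 → EuclideanSpace ℂ (Fin 3)) (x : E3) : ℂ :=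
  Complex.exp (Complex.I * k * (‖x‖ : ℂ)) * (‖x‖ : ℂ) * cdiv (fun z => ‖z‖⁻¹ • f z) x

theorem smooth_of_zero_near {F : Type*} [NormedAddCommGroup F] [NormedSpace ℝ F] (h : E3 → F)
    (h0 : h =ᶠ[nhds 0] 0) (h1 : ∀ x ≠ 0, ContDiffAt ℝ 2 h x) : ContDiff ℝ 2 h := by
  rw [contDiff_iff_contDiffAt]
  intro x
  rcases eq_or_ne x 0 with rfl | hx
  · exact (contDiffAt_const (c := (0:F))).congr_of_eventuallyEq h0
  · exact h1 x hx

section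
variable (k : ℂ) (f : E3 → EuclideanSpace ℂ (Fin 3)) (hf : ContDiff ℝ (⊤ : ℕ∞) f)
  (hs : HasCompactSupport f) (h0 : (0 : E3) ∉ tsupport f)

theorem src_zero_near (h0 : (0 : E3) ∉ tsupport f) : (fun z => ‖z‖⁻¹ • f z) =ᶠ[nhds 0] 0 := by
  have := notMem_tsupport_iff_eventuallyEq.1 h0
  filter_upwards [this] with x hx
  simp [hx]

theorem f_comp_smooth (hf : ContDiff ℝ (⊤ : ℕ∞) f) (i : Fin 3) : ContDiff ℝ (⊤ : ℕ∞) (fun x => f x i) := by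
  exact ((EuclideanSpace.proj (𝕜 := ℂ) i).restrictScalars ℝ).contDiff.comp hf

theorem cdiv_contDiffAt (hf : ContDiff ℝ (⊤ : ℕ∞) f) (x : E3) (hx : x ≠ 0) :
    ContDiffAt ℝ 2 (cdiv (fun z => ‖z‖⁻¹ • f z)) x := by
  unfold cdiv
  refine ContDiffAt.sum fun i _ => ?_
  have h1 : ContDiffAt ℝ 3 (fun z : E3 => (‖z‖⁻¹ • f z) i) x := by
    have a : ContDiffAt ℝ 3 (fun z : E3 => ‖z‖) x := contDiffAt_norm ℝ hx
    have b : ContDiffAt ℝ 3 (fun z : E3 => f z i) x :=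
      (contDiff_infty.1 (f_comp_smooth f hf i) 3).contDiffAt
    have c := (a.inv (norm_ne_zero_iff.2 hx)).smul b
    exact c
  have h2 : ContDiffAt ℝ 2 (fderiv ℝ (fun z : E3 => (‖z‖⁻¹ • f z) i)) x := h1.fderiv_right (by norm_num)
  exact h2.clm_apply contDiffAt_const

theorem cdiv_zero_near (h0 : (0 : E3) ∉ tsupport f) : cdiv (fun z => ‖z‖⁻¹ • f z) =ᶠ[nhds 0] 0 := by
  have := (src_zero_near f h0).eventuallyEq_nhds
  filter_upwards [this] with x hx
  simp only [cdiv, Pi.zero_apply]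
  refine Finset.sum_eq_zero fun i _ => ?_
  have : (fun z : E3 => (‖z‖⁻¹ • f z) i) =ᶠ[nhds x] fun _ => (0:ℂ) := by
    filter_upwards [hx] with z hz
    have hz : ‖z‖⁻¹ • f z = 0 := hz
    rw [hz]; rfl
  rw [this.fderiv_eq]; simp

theorem src_contDiff (hf : ContDiff ℝ (⊤ : ℕ∞) f) (h0 : (0 : E3) ∉ tsupport f) : ContDiff ℝ 2 (src k f) := by
  refine smooth_of_zero_near _ ?_ ?_
  · filter_upwards [cdiv_zero_near f h0] with x hx
    simp only [src, hx]; simp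
  · intro x hx
    unfold src
    have a : ContDiffAt ℝ 2 (fun z : E3 => (‖z‖ : ℂ)) x :=
      (Complex.ofRealCLM.contDiff.contDiffAt).comp x (contDiffAt_norm ℝ hx)
    exact (((contDiffAt_const.mul a).cexp).mul a).mul (cdiv_contDiffAt f hf x hx)

theorem src_cs (hs : HasCompactSupport f) : HasCompactSupport (src k f) := by
  have h1 : HasCompactSupport (cdiv (fun z => ‖z‖⁻¹ • f z)) := by
    refine HasCompactSupport.intro hs fun x hx => ?_
    have := (notMem_tsupport_iff_eventuallyEq.1 hx)
    simp only [cdiv]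
    refine Finset.sum_eq_zero fun i _ => ?_
    have : (fun z : E3 => (‖z‖⁻¹ • f z) i) =ᶠ[nhds x] fun _ => (0:ℂ) := by
      filter_upwards [this] with z hz
      rw [hz]; simp
    rw [this.fderiv_eq]; simp
  exact h1.mul_left

theorem src_eq (hf : ContDiff ℝ (⊤ : ℕ∞) f) (x : E3) (hx : x ≠ 0) :
    src k f x = Complex.exp (Complex.I * k * (‖x‖ : ℂ)) * ((∑ i, pd i (fun z => f z i) x) -
      (∑ i, (x i : ℂ) / (‖x‖ : ℂ) * f x i) / (‖x‖ : ℂ)) := by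
  have hxp : ‖x‖ ≠ 0 := norm_ne_zero_iff.2 hx
  have hxc : (‖x‖ : ℂ) ≠ 0 := by exact_mod_cast hxp
  have key : ∀ i, fderiv ℝ (fun z : E3 => (‖z‖⁻¹ • f z) i) x (ee i) =
      (‖x‖ : ℂ)⁻¹ * pd i (fun z => f z i) x - (x i : ℂ) / (‖x‖ : ℂ) ^ 3 * f x i := by
    intro i
    have d1 : DifferentiableAt ℝ (fun z : E3 => (‖z‖⁻¹ • f z) i) x := by
      have a : ContDiffAt ℝ 1 (fun z : E3 => ‖z‖) x := contDiffAt_norm ℝ hx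
      have b : ContDiffAt ℝ 1 (fun z : E3 => f z i) x :=
        ((f_comp_smooth f hf i).of_le (by exact_mod_cast le_top)).contDiffAt
      have c := (a.inv hxp).smul b
      exact ContDiffAt.differentiableAt (n := 1) c (by norm_num)
    have l1 := d1.hasFDerivAt.hasLineDerivAt (ee i)
    have l2 := radial_line (fun r => ((r⁻¹ : ℝ) : ℂ)) ((-(‖x‖ ^ 2)⁻¹ : ℝ) : ℂ) x hx
      (hasDerivAt_inv hxp).ofReal_comp i
    have l3 := pd_line i (fun z => f z i) x (((f_comp_smooth f hf i).differentiable (by simp)) x)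
    unfold HasLineDerivAt at l1 l2 l3
    have l4 := (l2.mul l3).congr_of_eventuallyEq
      (f₁ := fun t : ℝ => (‖x + t • ee i‖⁻¹ • f (x + t • ee i)) i) (Filter.Eventually.of_forall fun t => by simp)
    have := l1.unique l4
    rw [this]
    simp
    field_simp
    ring
  simp only [src, cdiv]
  rw [Finset.sum_congr rfl fun i _ => key i, mul_assoc, Finset.sum_sub_distrib, mul_sub, Finset.mul_sum, Finset.mul_sum, Finset.sum_div]
  congr 2
  · refine Finset.sum_congr rfl fun i _ => ?_
    field_simp
  · refine Finset.sum_congr rfl fun i _ => ?_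
    field_simp

theorem mu1_eq (R : ℝ) (hR : 0 < R) (σ : E3)  :
    mu1 k f R σ = (R : ℂ) * Complex.exp (Complex.I * k * ((-R : ℝ) : ℂ)) * cv k (src k f) (R • σ) := by
  have h1 : cv k (src k f) (R • σ) = ∫ y, GG k (R • σ - y) * src k f y := by
    rw [cv, ← integral_sub_left_eq_self (fun y => GG k y * src k f (R • σ - y)) volume (R • σ)]
    simp
  rw [h1, mu1, mul_assoc, ← integral_const_mul (Complex.exp (Complex.I * k * ((-R : ℝ) : ℂ)))]
  refine congrArg (fun z => (R:ℂ) * z) (integral_congr_ae (Filter.Eventually.of_forall fun y => ?_))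
  simp only [ker, GG, src]
  rcases eq_or_ne y 0 with rfl | hy
  · simp
  have hyp : (‖y‖ : ℂ) ≠ 0 := by exact_mod_cast norm_ne_zero_iff.2 hy
  have : Complex.I * k * ((-R + ‖R • σ - y‖ + ‖y‖ : ℝ) : ℂ) = Complex.I * k * ((-R : ℝ) : ℂ) +
    Complex.I * k * (‖R • σ - y‖ : ℂ) + Complex.I * k * (‖y‖ : ℂ) := by push_cast; ring
  rw [this, Complex.exp_add, Complex.exp_add]
  push_cast
  by_cases hz : (‖R • σ - y‖ : ℂ) = 0
  · simp [hz]
  field_simp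
end

/-- Decay class: exponential rate `b`, singularity of order `n` at the origin. -/
def Dec (b : ℝ) (n : ℕ) (F : E3 → ℂ) : Prop :=
  Measurable F ∧ ∃ A : ℝ, 0 ≤ A ∧ ∀ x ≠ 0, ‖F x‖ ≤ A * ((1 + ‖x‖⁻¹) ^ n * Real.exp (-b * ‖x‖))

theorem Dec.add {b : ℝ} {n : ℕ} {F G : E3 → ℂ} (hF : Dec b n F) (hG : Dec b n G) :
    Dec b n (fun x => F x + G x) := by
  obtain ⟨m1, A, hA, h1⟩ := hF
  obtain ⟨m2, B, hB, h2⟩ := hG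
  refine ⟨m1.add m2, A + B, by positivity, fun x hx => (norm_add_le _ _).trans ?_⟩
  rw [add_mul]; exact add_le_add (h1 x hx) (h2 x hx)

theorem Dec.mul {b c : ℝ} {n m : ℕ} {F G : E3 → ℂ} (hF : Dec b n F) (hG : Dec c m G) :
    Dec (b + c) (n + m) (fun x => F x * G x) := by
  obtain ⟨m1, A, hA, h1⟩ := hF
  obtain ⟨m2, B, hB, h2⟩ := hG
  refine ⟨m1.mul m2, A * B, by positivity, fun x hx => ?_⟩
  rw [norm_mul]
  calc _ ≤ _ := mul_le_mul (h1 x hx) (h2 x hx) (norm_nonneg _) (by positivity)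
    _ = _ := by
      rw [pow_add, show -(b + c) * ‖x‖ = -b * ‖x‖ + -c * ‖x‖ by ring, Real.exp_add]; ring

theorem Dec.mono {b : ℝ} {n m : ℕ} (hnm : n ≤ m) {F : E3 → ℂ} (hF : Dec b n F) : Dec b m F := by
  obtain ⟨m1, A, hA, h1⟩ := hF
  refine ⟨m1, A, hA, fun x hx => (h1 x hx).trans ?_⟩
  have : 1 ≤ 1 + ‖x‖⁻¹ := by have := inv_nonneg.2 (norm_nonneg x); linarith
  gcongr

theorem Dec.cast {b c : ℝ} (h : b = c) {n : ℕ} {F : E3 → ℂ} (hF : Dec b n F) : Dec c n F := h ▸ hF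

theorem Dec.conj {b : ℝ} {n : ℕ} {F : E3 → ℂ} (hF : Dec b n F) :
    Dec b n (fun x => (starRingEnd ℂ) (F x)) := by
  obtain ⟨m1, A, hA, h1⟩ := hF
  exact ⟨Complex.continuous_conj.measurable.comp m1, A, hA, fun x hx => by simpa using h1 x hx⟩

theorem Dec.const (c : ℂ) : Dec 0 0 (fun _ => c) :=
  ⟨measurable_const, ‖c‖, norm_nonneg _, fun x _ => by simp⟩

theorem Dec.sum {b : ℝ} {n : ℕ} {F : Fin 3 → E3 → ℂ} (hF : ∀ i, Dec b n (F i)) :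
    Dec b n (fun x => ∑ i, F i x) := by
  simp only [Fin.sum_univ_three]
  exact ((hF 0).add (hF 1)).add (hF 2)

theorem Dec.neg {b : ℝ} {n : ℕ} {F : E3 → ℂ} (hF : Dec b n F) : Dec b n (fun x => - F x) := by
  obtain ⟨m1, A, hA, h1⟩ := hF
  exact ⟨m1.neg, A, hA, fun x hx => by simpa using h1 x hx⟩

theorem Dec.sub {b : ℝ} {n : ℕ} {F G : E3 → ℂ} (hF : Dec b n F) (hG : Dec b n G) :
    Dec b n (fun x => F x - G x) := by
  simp only [sub_eq_add_neg]; exact hF.add hG.neg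

theorem ae_ne_zero : ∀ᵐ x : E3, x ≠ 0 := by
  have := (measure_singleton (μ := (volume : Measure E3)) 0)
  exact compl_mem_ae_iff.2 this

theorem Dec.integrable {b : ℝ} (hb : 0 < b) {F : E3 → ℂ} (hF : Dec b 2 F) : Integrable F := by
  obtain ⟨m1, A, hA, h1⟩ := hF
  refine ((dom_integrable b hb).const_mul (2 * A)).mono' m1.aestronglyMeasurable ?_
  filter_upwards [ae_ne_zero] with x hx
  refine (h1 x hx).trans ?_
  have : (1 + ‖x‖⁻¹) ^ 2 ≤ 2 * (1 + (‖x‖ ^ 2)⁻¹) := by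
    rw [← inv_pow]; nlinarith [sq_nonneg (‖x‖⁻¹ - 1)]
  calc A * ((1 + ‖x‖⁻¹) ^ 2 * Real.exp (-b * ‖x‖)) ≤ A * (2 * (1 + (‖x‖ ^ 2)⁻¹) * Real.exp (-b * ‖x‖)) := by
        gcongr
    _ = _ := by ring

theorem Dec.inv_norm : Dec 0 1 (fun x : E3 => (‖x‖ : ℂ)⁻¹) :=
  ⟨by fun_prop, 1, zero_le_one, fun x hx => by simp⟩

/-- radial unit vector component -/
noncomputable def nn (i : Fin 3) (x : E3) : ℂ := (x i : ℂ) / (‖x‖ : ℂ)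

theorem nn_norm_le (i : Fin 3) (x : E3) : ‖nn i x‖ ≤ 1 := by
  rw [nn, norm_div, Complex.norm_real, Complex.norm_real, norm_norm]
  exact div_le_one_of_le₀ (PiLp.norm_apply_le x i) (norm_nonneg _)

theorem Dec.nn (i : Fin 3) : Dec 0 0 (nn i) :=
  ⟨by unfold _root_.nn; fun_prop, 1, zero_le_one, fun x hx => by simpa using nn_norm_le i x⟩

theorem nn_conj (i : Fin 3) (x : E3) : (starRingEnd ℂ) (nn i x) = nn i x := by
  simp [nn]

theorem nn_sq (x : E3) (hx : x ≠ 0) : nn 0 x ^ 2 + nn 1 x ^ 2 + nn 2 x ^ 2 = 1 := by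
  have h := EuclideanSpace.real_norm_sq_eq x
  rw [Fin.sum_univ_three] at h
  have hx' : (‖x‖ : ℂ) ≠ 0 := by exact_mod_cast norm_ne_zero_iff.2 hx
  simp only [nn]
  field_simp
  exact_mod_cast h.symm

theorem nn_line (i : Fin 3) (x : E3) (hx : x ≠ 0) :
    HasLineDerivAt ℝ (nn i) ((‖x‖ : ℂ)⁻¹ - nn i x ^ 2 * (‖x‖ : ℂ)⁻¹) x (ee i) := by
  have hxp : ‖x‖ ≠ 0 := norm_ne_zero_iff.2 hx
  have hxc : (‖x‖ : ℂ) ≠ 0 := by exact_mod_cast hxp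
  have l2 := radial_line (fun r => ((r⁻¹ : ℝ) : ℂ)) ((-(‖x‖ ^ 2)⁻¹ : ℝ) : ℂ) x hx
      (hasDerivAt_inv hxp).ofReal_comp i
  have l1 : HasDerivAt (fun t : ℝ => (((x + t • ee i) i : ℝ) : ℂ)) 1 0 := by
    have : HasDerivAt (fun t : ℝ => x i + t) 1 0 := (hasDerivAt_id _).const_add _
    simpa using this.ofReal_comp
  unfold HasLineDerivAt at l2 ⊢
  have := l1.mul l2
  convert! this using 1
  · ext t; simp [nn, div_eq_mul_inv]
  · simp [nn]; field_simp; ring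

theorem line_mul {F G : E3 → ℂ} {F' G' : ℂ} {x v : E3} (hF : HasLineDerivAt ℝ F F' x v)
    (hG : HasLineDerivAt ℝ G G' x v) :
    HasLineDerivAt ℝ (fun y => F y * G y) (F' * G x + F x * G') x v := by
  unfold HasLineDerivAt at hF hG ⊢
  have := hF.mul hG
  simp only [zero_smul, add_zero] at this
  exact this

theorem line_add {F G : E3 → ℂ} {F' G' : ℂ} {x v : E3} (hF : HasLineDerivAt ℝ F F' x v)
    (hG : HasLineDerivAt ℝ G G' x v) :
    HasLineDerivAt ℝ (fun y => F y + G y) (F' + G') x v := by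
  unfold HasLineDerivAt at hF hG ⊢
  exact hF.add hG

theorem line_conj {F : E3 → ℂ} {F' : ℂ} {x v : E3} (hF : HasLineDerivAt ℝ F F' x v) :
    HasLineDerivAt ℝ (fun y => (starRingEnd ℂ) (F y)) ((starRingEnd ℂ) F') x v := by
  unfold HasLineDerivAt at hF ⊢
  exact Complex.conjCLE.toContinuousLinearMap.hasFDerivAt.comp_hasDerivAt 0 hF

theorem ibp_dec {b : ℝ} (hb : 0 < b) {F F' : E3 → ℂ} (v : E3) (hF : Dec b 1 F) (hF' : Dec b 2 F')
    (hd : ∀ x ≠ 0, HasLineDerivAt ℝ F (F' x) x v) : ∫ x, F' x = 0 := by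
  refine ibp0 F F' v hd ((hF.mono (by norm_num)).integrable hb) ?_ (hF'.integrable hb)
  have := ((Dec.inv_norm.mul hF).cast (zero_add b)).integrable hb
  refine this.norm.congr (Filter.Eventually.of_forall fun x => ?_)
  simp

theorem alg_one (p q n f d g : Fin 3 → ℂ) (u v s k kb eta W P E : ℂ)
    (hn : n 0 ^ 2 + n 1 ^ 2 + n 2 ^ 2 = 1) (he : 2 * eta = - Complex.I * (k - kb))
    (hh : ∑ i, d i = - k ^ 2 * u - E * ((∑ i, g i) - (∑ i, n i * f i) * s)) :
    ∑ i, ((2 * eta * W + P) * n i * (v * (p i + (s - Complex.I * k) * (u * n i))) +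
      W * (q i * (p i + (s - Complex.I * k) * (u * n i)) +
        v * (d i + (-s ^ 2 * n i * (u * n i) + (s - Complex.I * k) * (p i * n i + u * (s - n i ^ 2 * s))))) +
      ((Complex.I * k * E * n i * W + E * ((2 * eta * W + P) * n i)) * (v * f i) +
        E * W * (q i * f i + v * g i)))
    = W * (∑ i, (p i + (s - Complex.I * k) * (u * n i)) * (q i + (s + Complex.I * kb) * (v * n i)))
      + (P - 2 * Complex.I * k * W) * v * (∑ i, n i * (p i + (s - Complex.I * k) * (u * n i)))
      + E * (W * (∑ i, f i * (q i + (s + Complex.I * kb) * (v * n i))) + P * v * ∑ i, n i * f i) := by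
  simp only [Fin.sum_univ_three] at hh ⊢
  linear_combination (W*v*u*(-s^2 - (s - Complex.I * k)*s - (s - Complex.I * k)^2))*hn + W*v*hh +
    (W*v*((n 0 * (p 0 + (s - Complex.I * k) * (u * n 0)) + n 1 * (p 1 + (s - Complex.I * k) * (u * n 1))
      + n 2 * (p 2 + (s - Complex.I * k) * (u * n 2))) + E * (n 0 * f 0 + n 1 * f 1 + n 2 * f 2)))*he
      - W*v*u*k^2*Complex.I_sq

theorem alg_two (p q n : Fin 3 → ℂ) (u v s k kb eta W P : ℂ)
    (hn : n 0 ^ 2 + n 1 ^ 2 + n 2 ^ 2 = 1) (he : 2 * eta = - Complex.I * (k - kb)) :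
    ∑ i, ((2 * eta * W + P) * n i * (n i * (u * v)) + W * ((s - n i ^ 2 * s) * (u * v) + n i * (p i * v + u * q i)))
    = W * (v * (∑ i, n i * (p i + (s - Complex.I * k) * (u * n i))) + u * (∑ i, n i * (q i + (s + Complex.I * kb) * (v * n i))))
      + P * (u * v) := by
  simp only [Fin.sum_univ_three]
  linear_combination (2 * eta * W + P - W * s - W * (s - Complex.I * k) - W * (s + Complex.I * kb)) * u * v * hn + W * u * v * he

/-- logistic cutoff -/
noncomputable def psi (lam R r : ℝ) : ℝ := (1 + Real.exp (lam * (r - R)))⁻¹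

theorem psi_pos (lam R r : ℝ) : 0 < psi lam R r := by unfold psi; positivity

theorem psi_lt_one (lam R r : ℝ) : psi lam R r < 1 := by
  unfold psi
  exact inv_lt_one_of_one_lt₀ (by linarith [Real.exp_pos (lam * (r - R))])

theorem psi_deriv (lam R r : ℝ) :
    HasDerivAt (psi lam R) (- lam * psi lam R r * (1 - psi lam R r)) r := by
  have h1 : HasDerivAt (fun r => 1 + Real.exp (lam * (r - R))) (Real.exp (lam * (r - R)) * lam) r := by
    have := ((((hasDerivAt_id r).sub_const R).const_mul lam).exp).const_add 1
    simpa using this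
  have h2 := h1.inv (by positivity)
  convert! h2 using 1
  unfold psi
  field_simp
  ring

theorem psi_le_exp (lam R r : ℝ) : psi lam R r ≤ Real.exp (lam * R) * Real.exp (-lam * r) := by
  unfold psi
  rw [← Real.exp_add, show lam * R + -lam * r = -(lam * (r - R)) by ring, Real.exp_neg]
  apply inv_anti₀ (Real.exp_pos _)
  linarith

theorem psi_le_half (lam R r : ℝ) (hl : 0 < lam) (hr : R ≤ r) : psi lam R r ≤ 1 / 2 := by
  unfold psi
  rw [one_div]
  apply inv_anti₀ (by norm_num)
  have := Real.one_le_exp (x := lam * (r - R)) (by nlinarith)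
  linarith

theorem psi_self (lam R : ℝ) : psi lam R R = 1 / 2 := by
  unfold psi; norm_num

theorem psi_contDiff (lam R : ℝ) : ContDiff ℝ 1 (psi lam R) := by
  unfold psi
  refine ContDiff.inv (by fun_prop) fun x => by positivity

theorem psi_meas (lam R : ℝ) : Measurable (psi lam R) := by unfold psi; fun_prop

/-- standing assumptions for the energy estimate -/
structure Setup (k : ℂ) (u : E3 → ℂ) (f : Fin 3 → E3 → ℂ) : Prop where
  hk : 0 < k.im
  hu : ContDiff ℝ 2 u
  hub : Dec k.im 0 u
  hub1 : ∀ i, Dec k.im 0 (pd i u)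
  hub2 : ∀ i, Dec k.im 0 (pd i (pd i u))
  hf : ∀ i, ContDiff ℝ 1 (f i)
  hfs : ∀ i, HasCompactSupport (f i)
  heq : ∀ x ≠ 0, ∑ i, pd i (pd i u) x = - k ^ 2 * u x - Complex.exp (Complex.I * k * (‖x‖ : ℂ)) *
    ((∑ i, pd i (f i) x) - (∑ i, nn i x * f i x) * (‖x‖ : ℂ)⁻¹)

theorem Dec.of_cs (h : E3 → ℂ) (hc : Continuous h) (hs : HasCompactSupport h) : Dec 0 0 h := by
  obtain ⟨K, hK, hb⟩ := cs_bound h hc hs 0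
  exact ⟨hc.measurable, K, hK, fun x _ => by simpa using hb x⟩

section
variable {k : ℂ} {u : E3 → ℂ} {f : Fin 3 → E3 → ℂ}

/-- the modified gradient -/
noncomputable def VV (k : ℂ) (u : E3 → ℂ) (i : Fin 3) (x : E3) : ℂ :=
  pd i u x + ((‖x‖ : ℂ)⁻¹ - Complex.I * k) * (u x * nn i x)

/-- line derivative of VV i in direction i -/
noncomputable def VV' (k : ℂ) (u : E3 → ℂ) (i : Fin 3) (x : E3) : ℂ :=
  pd i (pd i u) x + (-((‖x‖ : ℂ)⁻¹) ^ 2 * nn i x * (u x * nn i x) +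
    ((‖x‖ : ℂ)⁻¹ - Complex.I * k) * (pd i u x * nn i x + u x * ((‖x‖ : ℂ)⁻¹ - nn i x ^ 2 * (‖x‖ : ℂ)⁻¹)))

/-- weight -/
noncomputable def ww (k : ℂ) (R r : ℝ) : ℝ := Real.exp (2 * k.im * r) * psi (k.im / 4) R r

/-- derivative part of the weight -/
noncomputable def pp (k : ℂ) (R r : ℝ) : ℝ :=
  Real.exp (2 * k.im * r) * (- (k.im / 4) * psi (k.im / 4) R r * (1 - psi (k.im / 4) R r))

theorem Dec.cc (k : ℂ) : Dec 0 1 (fun x : E3 => (‖x‖ : ℂ)⁻¹ - Complex.I * k) :=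
  Dec.inv_norm.sub ((Dec.const _).mono (by norm_num))

theorem ww_deriv (k : ℂ) (R r : ℝ) : HasDerivAt (ww k R) (2 * k.im * ww k R r + pp k R r) r := by
  have h1 : HasDerivAt (fun r => Real.exp (2 * k.im * r)) (Real.exp (2 * k.im * r) * (2 * k.im)) r := by
    have := ((hasDerivAt_id r).const_mul (2 * k.im)).exp
    simpa using this
  have := h1.mul (psi_deriv (k.im / 4) R r)
  convert! this using 1
  unfold ww pp; ring

theorem ww_pos (k : ℂ) (R r : ℝ) : 0 < ww k R r := mul_pos (Real.exp_pos _) (psi_pos _ _ _)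

theorem pp_nonpos (k : ℂ) (hk : 0 < k.im) (R r : ℝ) : pp k R r ≤ 0 := by
  have h1 := psi_pos (k.im/4) R r
  have h2 := psi_lt_one (k.im/4) R r
  have : 0 ≤ Real.exp (2 * k.im * r) * ((k.im / 4) * psi (k.im / 4) R r * (1 - psi (k.im / 4) R r)) := by
    have : 0 ≤ 1 - psi (k.im / 4) R r := by linarith
    positivity
  unfold pp; linarith

theorem pp_le (k : ℂ) (hk : 0 < k.im) (R r : ℝ) : - pp k R r ≤ k.im / 4 * ww k R r := by
  have h1 := psi_pos (k.im/4) R r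
  have h2 := psi_lt_one (k.im/4) R r
  have e : k.im / 4 * ww k R r - - pp k R r = Real.exp (2 * k.im * r) * ((k.im / 4) * psi (k.im / 4) R r * psi (k.im / 4) R r) := by
    unfold pp ww; ring
  have : 0 ≤ Real.exp (2 * k.im * r) * ((k.im / 4) * psi (k.im / 4) R r * psi (k.im / 4) R r) := by
    positivity
  linarith

theorem le_pp (k : ℂ) (hk : 0 < k.im) (R r : ℝ) (hr : R ≤ r) : k.im / 8 * ww k R r ≤ - pp k R r := by
  have h1 := psi_pos (k.im/4) R r
  have h2 := psi_le_half (k.im/4) R r (by positivity) hr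
  have e : - pp k R r - k.im / 8 * ww k R r = Real.exp (2 * k.im * r) * ((k.im / 4) * psi (k.im / 4) R r * (1/2 - psi (k.im / 4) R r)) := by
    unfold pp ww; ring
  have : 0 ≤ Real.exp (2 * k.im * r) * ((k.im / 4) * psi (k.im / 4) R r * (1/2 - psi (k.im / 4) R r)) := by
    have : 0 ≤ 1/2 - psi (k.im / 4) R r := by linarith
    positivity
  linarith

theorem ww_meas (k : ℂ) (R : ℝ) : Measurable (ww k R) := by
  have := psi_meas (k.im / 4) R
  unfold ww; fun_prop

theorem pp_meas (k : ℂ) (R : ℝ) : Measurable (pp k R) := by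
  have := psi_meas (k.im / 4) R
  unfold pp; fun_prop

theorem ww_le (k : ℂ) (R r : ℝ) :
    ww k R r ≤ Real.exp (k.im / 4 * R) * Real.exp (-(k.im / 4 - 2 * k.im) * r) := by
  have := psi_le_exp (k.im / 4) R r
  unfold ww
  calc _ ≤ Real.exp (2 * k.im * r) * (Real.exp (k.im / 4 * R) * Real.exp (-(k.im / 4) * r)) := by gcongr
    _ = _ := by
      rw [show -(k.im / 4 - 2 * k.im) * r = 2 * k.im * r + -(k.im / 4) * r by ring, Real.exp_add]; ring

theorem Dec.ww (k : ℂ) (R : ℝ) : Dec (k.im / 4 - 2 * k.im) 0 (fun x : E3 => ((ww k R ‖x‖ : ℝ) : ℂ)) := by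
  have := ww_meas k R
  refine ⟨by fun_prop, Real.exp (k.im / 4 * R), (Real.exp_pos _).le, fun x _ => ?_⟩
  rw [Complex.norm_real, Real.norm_of_nonneg (ww_pos _ _ _).le]
  simpa using ww_le k R ‖x‖

theorem Dec.pp (k : ℂ) (hk : 0 < k.im) (R : ℝ) : Dec (k.im / 4 - 2 * k.im) 0 (fun x : E3 => ((pp k R ‖x‖ : ℝ) : ℂ)) := by
  have := pp_meas k R
  refine ⟨by fun_prop, k.im / 4 * Real.exp (k.im / 4 * R), by positivity, fun x _ => ?_⟩
  rw [Complex.norm_real, Real.norm_of_nonpos (pp_nonpos k hk _ _)]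
  refine (pp_le k hk R _).trans ?_
  have := mul_le_mul_of_nonneg_left (ww_le k R ‖x‖) (by positivity : 0 ≤ k.im / 4)
  simpa [mul_assoc] using this

theorem Dec.ex (k : ℂ) : Dec k.im 0 (fun x : E3 => Complex.exp (Complex.I * k * (‖x‖ : ℂ))) :=
  ⟨by fun_prop, 1, zero_le_one, fun x _ => by rw [norm_exp_ik]; simp⟩

theorem VV_dec (S : Setup k u f) (i : Fin 3) : Dec k.im 1 (VV k u i) := by
  have h1 := (S.hub1 i).mono (m := 1) (by norm_num)
  have h2 := ((Dec.cc k).mul (S.hub.mul (Dec.nn i))).cast (c := k.im) (by ring)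
  exact h1.add h2

theorem VV'_dec (S : Setup k u f) (i : Fin 3) : Dec k.im 2 (VV' k u i) := by
  have h1 := (S.hub2 i).mono (m := 2) (by norm_num)
  have h2 := (S.hub.mul (Dec.nn i))
  have a : Dec 0 2 (fun x : E3 => -((‖x‖ : ℂ)⁻¹) ^ 2) := by
    have := (Dec.inv_norm.mul Dec.inv_norm).neg.cast (c := 0) (by ring)
    simpa only [← sq] using this
  have h3 := ((a.mul (Dec.nn i)).mul h2).cast (c := k.im) (by ring)
  have b : Dec 0 1 (fun x : E3 => (‖x‖ : ℂ)⁻¹ - nn i x ^ 2 * (‖x‖ : ℂ)⁻¹) := by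
    have := Dec.inv_norm.sub ((((Dec.nn i).mul (Dec.nn i)).mul Dec.inv_norm).cast (c := 0) (by ring))
    simpa only [← sq] using this
  have h4 := ((Dec.cc k).mul ((((S.hub1 i).mul (Dec.nn i)).mono (m := 1) (by norm_num)).add
    ((S.hub.mul b)))).cast (c := k.im) (by ring)
  exact h1.add (h3.add h4)

theorem VV_line (S : Setup k u f) (i : Fin 3) (x : E3) (hx : x ≠ 0) :
    HasLineDerivAt ℝ (VV k u i) (VV' k u i x) x (ee i) := by
  have hxp : ‖x‖ ≠ 0 := norm_ne_zero_iff.2 hx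
  have hpd : ContDiff ℝ 1 (pd i u) := pd_contDiff (n := 1) i u (by exact_mod_cast S.hu)
  have l0 := pd_line i u x (S.hu.differentiable (by norm_num) x)
  have l1 := pd_line i (pd i u) x (hpd.differentiable (by norm_num) x)
  have l2 := radial_line (fun r => ((r⁻¹ : ℝ) : ℂ) - Complex.I * k) ((-(‖x‖ ^ 2)⁻¹ : ℝ) : ℂ) x hx
      ((hasDerivAt_inv hxp).ofReal_comp.sub_const _) i
  have l3 := line_add l1 (line_mul l2 (line_mul l0 (nn_line i x hx)))
  simp only [Complex.ofReal_inv] at l3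
  have e : VV' k u i x = pd i (pd i u) x +
          (((-(‖x‖ ^ 2)⁻¹ : ℝ) : ℂ) * ((x i : ℂ) / (‖x‖ : ℂ)) * (u x * nn i x) +
            ((‖x‖ : ℂ)⁻¹ - Complex.I * k) * (pd i u x * nn i x + u x * ((‖x‖ : ℂ)⁻¹ - nn i x ^ 2 * (‖x‖ : ℂ)⁻¹))) := by
    simp [VV', nn]
  rw [e]
  exact l3
end

section
variable {k : ℂ} {u : E3 → ℂ} {f : Fin 3 → E3 → ℂ}

theorem VV_conj (k : ℂ) (u : E3 → ℂ) (i : Fin 3) (x : E3) :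
    (starRingEnd ℂ) (VV k u i x) = (starRingEnd ℂ) (pd i u x) +
      ((‖x‖ : ℂ)⁻¹ + Complex.I * (starRingEnd ℂ) k) * ((starRingEnd ℂ) (u x) * nn i x) := by
  simp [VV, nn_conj]

theorem two_im (k : ℂ) : 2 * (k.im : ℂ) = - Complex.I * (k - (starRingEnd ℂ) k) := by
  rw [Complex.sub_conj]; push_cast; linear_combination (2 * (k.im : ℂ)) * Complex.I_sq

/-- first divergence -/
noncomputable def S1 (k : ℂ) (u : E3 → ℂ) (f : Fin 3 → E3 → ℂ) (R : ℝ) (x : E3) : ℂ :=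
  (ww k R ‖x‖ : ℂ) * (∑ i, VV k u i x * (starRingEnd ℂ) (VV k u i x))
  + ((pp k R ‖x‖ : ℂ) - 2 * Complex.I * k * (ww k R ‖x‖ : ℂ)) * (starRingEnd ℂ) (u x) * (∑ i, nn i x * VV k u i x)
  + Complex.exp (Complex.I * k * (‖x‖ : ℂ)) *
    ((ww k R ‖x‖ : ℂ) * (∑ i, f i x * (starRingEnd ℂ) (VV k u i x)) +
      (pp k R ‖x‖ : ℂ) * (starRingEnd ℂ) (u x) * ∑ i, nn i x * f i x)

/-- second divergence -/
noncomputable def S2 (k : ℂ) (u : E3 → ℂ) (R : ℝ) (x : E3) : ℂ :=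
  (ww k R ‖x‖ : ℂ) * ((starRingEnd ℂ) (u x) * (∑ i, nn i x * VV k u i x) +
    u x * (∑ i, nn i x * (starRingEnd ℂ) (VV k u i x))) + (pp k R ‖x‖ : ℂ) * (u x * (starRingEnd ℂ) (u x))

theorem ww_line (k : ℂ) (R : ℝ) (i : Fin 3) (x : E3) (hx : x ≠ 0) :
    HasLineDerivAt ℝ (fun x : E3 => (ww k R ‖x‖ : ℂ))
      ((2 * (k.im : ℂ) * (ww k R ‖x‖ : ℂ) + (pp k R ‖x‖ : ℂ)) * nn i x) x (ee i) := by
  have := radial_line (fun r => ((ww k R r : ℝ) : ℂ)) _ x hx (ww_deriv k R ‖x‖).ofReal_comp i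
  simpa [nn] using this

theorem ex_line (k : ℂ) (i : Fin 3) (x : E3) (hx : x ≠ 0) :
    HasLineDerivAt ℝ (fun x : E3 => Complex.exp (Complex.I * k * (‖x‖ : ℂ)))
      (Complex.I * k * Complex.exp (Complex.I * k * (‖x‖ : ℂ)) * nn i x) x (ee i) := by
  have hE : HasDerivAt (fun r : ℝ => Complex.exp (Complex.I * k * (r : ℂ)))
      (Complex.I * k * Complex.exp (Complex.I * k * (‖x‖ : ℂ))) ‖x‖ := by
    have := (((hasDerivAt_id ‖x‖).ofReal_comp).const_mul (Complex.I * k)).cexp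
    convert! this using 1
    simp; ring
  exact radial_line _ _ x hx hE i

theorem Dec.w' (k : ℂ) (hk : 0 < k.im) (R : ℝ) (i : Fin 3) : Dec (k.im / 4 - 2 * k.im) 0
    (fun x : E3 => (2 * (k.im : ℂ) * (_root_.ww k R ‖x‖ : ℂ) + (_root_.pp k R ‖x‖ : ℂ)) * _root_.nn i x) := by
  have h := (((Dec.const (2 * (k.im : ℂ))).mul (Dec.ww k R)).cast (c := k.im / 4 - 2 * k.im) (by ring)).add (Dec.pp k hk R)
  exact (h.mul (Dec.nn i)).cast (by ring)

theorem S1_int (S : Setup k u f) (R : ℝ) : Integrable (S1 k u f R) ∧ ∫ x, S1 k u f R x = 0 := by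
  have hk := S.hk
  have hk4 : 0 < k.im / 4 := by positivity
  let F' : Fin 3 → E3 → ℂ := fun i x =>
    (2 * (k.im : ℂ) * (ww k R ‖x‖ : ℂ) + (pp k R ‖x‖ : ℂ)) * nn i x * ((starRingEnd ℂ) (u x) * VV k u i x) +
    (ww k R ‖x‖ : ℂ) * ((starRingEnd ℂ) (pd i u x) * VV k u i x + (starRingEnd ℂ) (u x) * VV' k u i x) +
    ((Complex.I * k * Complex.exp (Complex.I * k * (‖x‖ : ℂ)) * nn i x * (ww k R ‖x‖ : ℂ) +
      Complex.exp (Complex.I * k * (‖x‖ : ℂ)) * ((2 * (k.im : ℂ) * (ww k R ‖x‖ : ℂ) + (pp k R ‖x‖ : ℂ)) * nn i x)) *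
        ((starRingEnd ℂ) (u x) * f i x) +
      Complex.exp (Complex.I * k * (‖x‖ : ℂ)) * (ww k R ‖x‖ : ℂ) *
        ((starRingEnd ℂ) (pd i u x) * f i x + (starRingEnd ℂ) (u x) * pd i (f i) x))
  let F : Fin 3 → E3 → ℂ := fun i x =>
    (ww k R ‖x‖ : ℂ) * ((starRingEnd ℂ) (u x) * VV k u i x) +
    Complex.exp (Complex.I * k * (‖x‖ : ℂ)) * (ww k R ‖x‖ : ℂ) * ((starRingEnd ℂ) (u x) * f i x)
  have hw := Dec.ww k R
  have hw' := Dec.w' k hk R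
  have hE := Dec.ex k
  have hub := S.hub.conj
  have hub1 := fun i => (S.hub1 i).conj
  have hV := VV_dec S
  have hV' := VV'_dec S
  have hf := fun i => Dec.of_cs _ (S.hf i).continuous (S.hfs i)
  have hf1 := fun i => Dec.of_cs _ (pd_contDiff (n := 0) i _ (by simpa using S.hf i)).continuous (pd_cs i _ (S.hfs i))
  have dF : ∀ i, Dec (k.im / 4) 1 (F i) := by
    intro i
    have a1 := (hw.mul (hub.mul (hV i))).cast (c := k.im / 4) (by ring)
    have a2 := ((hE.mul hw).mul (hub.mul (hf i))).cast (c := k.im / 4) (by ring)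
    exact a1.add (a2.mono (by norm_num))
  have dF' : ∀ i, Dec (k.im / 4) 2 (F' i) := by
    intro i
    have a1 := ((hw' i).mul (hub.mul (hV i))).cast (c := k.im / 4) (by ring)
    have a2 := (hw.mul ((((hub1 i).mul (hV i)).mono (m := 2) (by norm_num)).add
      ((hub.mul (hV' i)).mono (m := 2) (by norm_num)))).cast (c := k.im / 4) (by ring)
    have b1 := (((((Dec.const (Complex.I * k)).mul hE).mul (Dec.nn i)).mul hw).cast (c := k.im / 4 - k.im) (by ring)).add
      ((hE.mul (hw' i)).cast (c := k.im / 4 - k.im) (by ring))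
    have a3 := (b1.mul (hub.mul (hf i))).cast (c := k.im / 4) (by ring)
    have a4 := ((hE.mul hw).mul (((hub1 i).mul (hf i)).add (hub.mul (hf1 i)))).cast (c := k.im / 4) (by ring)
    exact ((a1.mono (by norm_num)).add (a2.mono (by norm_num))).add ((a3.add a4).mono (by norm_num))
  have hd : ∀ i, ∀ x ≠ 0, HasLineDerivAt ℝ (F i) (F' i x) x (ee i) := by
    intro i x hx
    have lu := line_conj (pd_line i u x (S.hu.differentiable (by norm_num) x))
    have lf := pd_line i (f i) x ((S.hf i).differentiable (by norm_num) x)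
    exact line_add (line_mul (ww_line k R i x hx) (line_mul lu (VV_line S i x hx)))
      (line_mul (line_mul (ex_line k i x hx) (ww_line k R i x hx)) (line_mul lu lf))
  have hz : ∀ i, ∫ x, F' i x = 0 := fun i => ibp_dec hk4 (ee i) (dF i) (dF' i) (hd i)
  have hsum : (fun x => ∑ i, F' i x) =ᵐ[volume] S1 k u f R := by
    filter_upwards [ae_ne_zero] with x hx
    have := alg_one (fun i => pd i u x) (fun i => (starRingEnd ℂ) (pd i u x)) (fun i => nn i x) (fun i => f i x)
      (fun i => pd i (pd i u) x) (fun i => pd i (f i) x) (u x) ((starRingEnd ℂ) (u x)) ((‖x‖ : ℂ)⁻¹) k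
      ((starRingEnd ℂ) k) (k.im : ℂ) (ww k R ‖x‖ : ℂ) (pp k R ‖x‖ : ℂ) (Complex.exp (Complex.I * k * (‖x‖ : ℂ)))
      (nn_sq x hx) (two_im k) (S.heq x hx)
    unfold S1
    simp only [VV_conj]
    exact this
  refine ⟨(Dec.integrable hk4 (Dec.sum dF')).congr hsum, ?_⟩
  rw [← integral_congr_ae hsum, integral_finsetSum _ fun i _ => (dF' i).integrable hk4]
  simp [hz]

theorem S2_int (S : Setup k u f) (R : ℝ) : Integrable (S2 k u R) ∧ ∫ x, S2 k u R x = 0 := by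
  have hk := S.hk
  have hk4 : 0 < k.im / 4 := by positivity
  let F' : Fin 3 → E3 → ℂ := fun i x =>
    (2 * (k.im : ℂ) * (ww k R ‖x‖ : ℂ) + (pp k R ‖x‖ : ℂ)) * nn i x * (nn i x * (u x * (starRingEnd ℂ) (u x))) +
    (ww k R ‖x‖ : ℂ) * (((‖x‖ : ℂ)⁻¹ - nn i x ^ 2 * (‖x‖ : ℂ)⁻¹) * (u x * (starRingEnd ℂ) (u x)) +
      nn i x * (pd i u x * (starRingEnd ℂ) (u x) + u x * (starRingEnd ℂ) (pd i u x)))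
  let F : Fin 3 → E3 → ℂ := fun i x => (ww k R ‖x‖ : ℂ) * (nn i x * (u x * (starRingEnd ℂ) (u x)))
  have hw := Dec.ww k R
  have hw' := Dec.w' k hk R
  have hu := S.hub
  have hub := S.hub.conj
  have hu1 := S.hub1
  have hub1 := fun i => (S.hub1 i).conj
  have dF : ∀ i, Dec (k.im / 4) 1 (F i) := by
    intro i
    exact ((hw.mul ((Dec.nn i).mul (hu.mul hub))).cast (c := k.im / 4) (by ring)).mono (by norm_num)
  have dF' : ∀ i, Dec (k.im / 4) 2 (F' i) := by
    intro i
    have b : Dec 0 1 (fun x : E3 => (‖x‖ : ℂ)⁻¹ - nn i x ^ 2 * (‖x‖ : ℂ)⁻¹) := by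
      have := Dec.inv_norm.sub ((((Dec.nn i).mul (Dec.nn i)).mul Dec.inv_norm).cast (c := 0) (by ring))
      simpa only [← sq] using this
    have a1 := ((hw' i).mul ((Dec.nn i).mul (hu.mul hub))).cast (c := k.im / 4) (by ring)
    have a2 := (hw.mul (((b.mul (hu.mul hub)).mono (m := 2) (by norm_num)).add
      (((Dec.nn i).mul (((hu1 i).mul hub).add (hu.mul (hub1 i)))).mono (m := 2) (by norm_num)))).cast (c := k.im / 4) (by ring)
    exact (a1.mono (by norm_num)).add (a2.mono (by norm_num))
  have hd : ∀ i, ∀ x ≠ 0, HasLineDerivAt ℝ (F i) (F' i x) x (ee i) := by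
    intro i x hx
    have lu := (pd_line i u x (S.hu.differentiable (by norm_num) x))
    exact line_mul (ww_line k R i x hx) (line_mul (nn_line i x hx) (line_mul lu (line_conj lu)))
  have hz : ∀ i, ∫ x, F' i x = 0 := fun i => ibp_dec hk4 (ee i) (dF i) (dF' i) (hd i)
  have hsum : (fun x => ∑ i, F' i x) =ᵐ[volume] S2 k u R := by
    filter_upwards [ae_ne_zero] with x hx
    have := alg_two (fun i => pd i u x) (fun i => (starRingEnd ℂ) (pd i u x)) (fun i => nn i x)
      (u x) ((starRingEnd ℂ) (u x)) ((‖x‖ : ℂ)⁻¹) k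
      ((starRingEnd ℂ) k) (k.im : ℂ) (ww k R ‖x‖ : ℂ) (pp k R ‖x‖ : ℂ)
      (nn_sq x hx) (two_im k)
    unfold S2
    simp only [VV_conj]
    exact this
  refine ⟨(Dec.integrable hk4 (Dec.sum dF')).congr hsum, ?_⟩
  rw [← integral_congr_ae hsum, integral_finsetSum _ fun i _ => (dF' i).integrable hk4]
  simp [hz]
end

theorem real_lower (η K ψ m p a G : ℝ) (hη : 0 < η) (hK : η ≤ K) (hψ : 0 ≤ ψ) (hψ1 : ψ ≤ 1) (hm : 0 ≤ m)
    (hm1 : m ≤ η / 4 * ψ) :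
    η / 2 * (ψ * p ^ 2) + K ^ 2 / 2 * (m * a ^ 2) - 2 * K ^ 2 / η * G ^ 2 ≤
      η * (ψ * p ^ 2) + K ^ 2 * (m * a ^ 2) - K * (m * a * p) - K * (ψ * G * p) - K * (m * a * G) := by
  have e1 : 0 ≤ m * (K * a / 2 - p) ^ 2 := by positivity
  have e2 : m * p ^ 2 ≤ η / 4 * ψ * p ^ 2 := by gcongr
  have e3 : 0 ≤ ψ * (η / 4) * (p - 2 * K / η * G) ^ 2 := by positivity
  have e3' : ψ * (η / 4) * (p - 2 * K / η * G) ^ 2 = ψ * η / 4 * p ^ 2 - K * (ψ * G * p) + ψ * (K ^ 2 / η * G ^ 2) := by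
    field_simp; ring
  have e4 : ψ * (K ^ 2 / η * G ^ 2) ≤ 1 * (K ^ 2 / η * G ^ 2) := by gcongr
  have e5 : 0 ≤ m * (K * a / 2 - G) ^ 2 := by positivity
  have e6 : m * G ^ 2 ≤ η / 4 * 1 * G ^ 2 := by
    gcongr; exact hm1.trans (by gcongr)
  have e7 : η / 4 * G ^ 2 ≤ K ^ 2 / η * G ^ 2 := by
    have : η / 4 ≤ K ^ 2 / η := by
      rw [le_div_iff₀ hη]
      nlinarith
    exact mul_le_mul_of_nonneg_right this (sq_nonneg _)
  have e8 : 2 * K ^ 2 / η * G ^ 2 = K ^ 2 / η * G ^ 2 + K ^ 2 / η * G ^ 2 := by ring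
  nlinarith

theorem cs3 (a b : Fin 3 → ℂ) : ‖∑ i, a i * b i‖ ≤ Real.sqrt (∑ i, ‖a i‖ ^ 2) * Real.sqrt (∑ i, ‖b i‖ ^ 2) := by
  have h1 : ‖∑ i, a i * b i‖ ≤ ∑ i, ‖a i‖ * ‖b i‖ := by
    refine (norm_sum_le _ _).trans_eq ?_
    simp
  refine h1.trans ?_
  exact Real.sum_mul_le_sqrt_mul_sqrt _ _ _

section
variable {k : ℂ} {u : E3 → ℂ} {f : Fin 3 → E3 → ℂ}

theorem nn_sum (x : E3) (hx : x ≠ 0) : ∑ i, ‖nn i x‖ ^ 2 = 1 := by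
  have h := nn_sq x hx
  have : ∀ i, (nn i x) ^ 2 = ((‖nn i x‖ ^ 2 : ℝ) : ℂ) := by
    intro i
    have := Complex.mul_conj (nn i x)
    rw [nn_conj, ← sq] at this
    rw [this, Complex.normSq_eq_norm_sq]
  rw [this, this, this] at h
  rw [Fin.sum_univ_three]
  exact_mod_cast h

/-- energy density -/
noncomputable def BB (k : ℂ) (u : E3 → ℂ) (R : ℝ) (x : E3) : ℝ :=
  k.im / 2 * (ww k R ‖x‖ * ∑ i, ‖VV k u i x‖ ^ 2) + ‖k‖ ^ 2 / 2 * (- pp k R ‖x‖ * ‖u x‖ ^ 2)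

theorem Z_lower (hk : 0 < k.im) (R : ℝ) (x : E3) (hx : x ≠ 0) :
    BB k u R x - 2 * ‖k‖ ^ 2 / k.im * (∑ i, ‖f i x‖ ^ 2) ≤
      (Complex.I * (starRingEnd ℂ) k * S1 k u f R x).re - ‖k‖ ^ 2 * (S2 k u R x).re := by
  set A := ∑ i, ‖VV k u i x‖ ^ 2 with hA
  set N := ∑ i, ‖f i x‖ ^ 2 with hN
  have hA0 : 0 ≤ A := Finset.sum_nonneg fun i _ => by positivity
  have hN0 : 0 ≤ N := Finset.sum_nonneg fun i _ => by positivity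
  set vr := ∑ i, nn i x * VV k u i x with hvr
  set fr := ∑ i, nn i x * f i x with hfr
  set fv := ∑ i, f i x * (starRingEnd ℂ) (VV k u i x) with hfv
  have b1 : ‖vr‖ ≤ Real.sqrt A := by
    have := cs3 (fun i => nn i x) (fun i => VV k u i x)
    rw [nn_sum x hx] at this; simpa using this
  have b2 : ‖fr‖ ≤ Real.sqrt N := by
    have := cs3 (fun i => nn i x) (fun i => f i x)
    rw [nn_sum x hx] at this; simpa using this
  have b3 : ‖fv‖ ≤ Real.sqrt N * Real.sqrt A := by
    have := cs3 (fun i => f i x) (fun i => (starRingEnd ℂ) (VV k u i x))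
    simpa using this
  set t := Real.exp (k.im * ‖x‖) with ht
  have ht0 : 0 < t := Real.exp_pos _
  have hT : Real.exp (2 * k.im * ‖x‖) = t ^ 2 := by rw [ht, ← Real.exp_nat_mul]; congr 1; push_cast; ring
  set ψ := psi (k.im / 4) R ‖x‖ with hψ
  have hψ0 : 0 < ψ := psi_pos _ _ _
  have hψ1 : ψ < 1 := psi_lt_one _ _ _
  set m := (k.im / 4) * ψ * (1 - ψ) with hm
  have hm0 : 0 ≤ m := by have : 0 ≤ 1 - ψ := by linarith
                         positivity
  have hm1 : m ≤ k.im / 4 * ψ := by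
    have : 0 ≤ (k.im / 4) * ψ * ψ := by positivity
    rw [hm]; linarith
  have hww : ww k R ‖x‖ = t ^ 2 * ψ := by rw [ww, hT]
  have hpp : pp k R ‖x‖ = - (t ^ 2 * m) := by rw [pp, hT, hm]; ring
  set E := Complex.exp (Complex.I * k * (‖x‖ : ℂ)) with hE
  have hEn : ‖E‖ * t = 1 := by
    rw [hE, norm_exp_ik, ht, ← Real.exp_add]; simp
  have hVV : ∑ i, VV k u i x * (starRingEnd ℂ) (VV k u i x) = (A : ℂ) := by
    rw [hA]; push_cast
    refine Finset.sum_congr rfl fun i _ => ?_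
    rw [Complex.mul_conj, Complex.normSq_eq_norm_sq]; push_cast; rfl
  have hkk : (starRingEnd ℂ) k * k = ((‖k‖ ^ 2 : ℝ) : ℂ) := by
    rw [mul_comm, Complex.mul_conj, Complex.normSq_eq_norm_sq]
  have hS1 : Complex.I * (starRingEnd ℂ) k * S1 k u f R x =
      ((t ^ 2 * ψ * A : ℝ) : ℂ) * (Complex.I * (starRingEnd ℂ) k)
      - ((t ^ 2 * m : ℝ) : ℂ) * (Complex.I * (starRingEnd ℂ) k * ((starRingEnd ℂ) (u x) * vr))
      + ((2 * ‖k‖ ^ 2 * (t ^ 2 * ψ) : ℝ) : ℂ) * ((starRingEnd ℂ) (u x) * vr)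
      + ((t ^ 2 * ψ : ℝ) : ℂ) * (Complex.I * (starRingEnd ℂ) k * E * fv)
      - ((t ^ 2 * m : ℝ) : ℂ) * (Complex.I * (starRingEnd ℂ) k * E * (starRingEnd ℂ) (u x) * fr) := by
    rw [S1, hVV, hww, hpp, ← hvr, ← hfv, ← hfr, ← hE]
    push_cast
    push_cast at hkk
    linear_combination (-2 * t ^ 2 * ψ * (starRingEnd ℂ) (u x) * vr : ℂ) * ((starRingEnd ℂ) k * k * Complex.I_sq) +
      (2 * t ^ 2 * ψ * (starRingEnd ℂ) (u x) * vr : ℂ) * hkk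
  have hS2 : (S2 k u R x).re = 2 * (t ^ 2 * ψ) * ((starRingEnd ℂ) (u x) * vr).re - t ^ 2 * m * ‖u x‖ ^ 2 := by
    have e : u x * (∑ i, nn i x * (starRingEnd ℂ) (VV k u i x)) = (starRingEnd ℂ) ((starRingEnd ℂ) (u x) * vr) := by
      rw [hvr]; simp [nn_conj]
    rw [S2, e, ← hvr, hww, hpp, Complex.mul_conj, Complex.normSq_eq_norm_sq, Complex.add_conj]
    simp only [← Complex.ofReal_mul, ← Complex.ofReal_add, Complex.ofReal_re]
    ring
  rw [hS1, hS2]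
  have hre : (Complex.I * (starRingEnd ℂ) k).re = k.im := by simp
  simp only [Complex.add_re, Complex.sub_re, Complex.re_ofReal_mul, hre]
  have c1 : (Complex.I * (starRingEnd ℂ) k * ((starRingEnd ℂ) (u x) * vr)).re ≤ ‖k‖ * (‖u x‖ * Real.sqrt A) := by
    refine (Complex.re_le_norm _).trans ?_
    simp only [norm_mul, Complex.norm_I, one_mul, RCLike.norm_conj]
    gcongr
  have c2 : - (‖k‖ * ‖E‖ * (Real.sqrt N * Real.sqrt A)) ≤ (Complex.I * (starRingEnd ℂ) k * E * fv).re := by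
    have h := (abs_le.1 (Complex.abs_re_le_norm (Complex.I * (starRingEnd ℂ) k * E * fv))).1
    refine le_trans ?_ h
    simp only [norm_mul, Complex.norm_I, one_mul, RCLike.norm_conj]
    rw [neg_le_neg_iff]
    gcongr
  have c3 : (Complex.I * (starRingEnd ℂ) k * E * (starRingEnd ℂ) (u x) * fr).re ≤ ‖k‖ * ‖E‖ * ‖u x‖ * Real.sqrt N := by
    refine (Complex.re_le_norm _).trans ?_
    simp only [norm_mul, Complex.norm_I, one_mul, RCLike.norm_conj]
    gcongr
  have hKk : k.im ≤ ‖k‖ := (le_abs_self _).trans (Complex.abs_im_le_norm k)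
  have main := real_lower k.im ‖k‖ ψ m (t * Real.sqrt A) (t * ‖u x‖) (Real.sqrt N) hk hKk hψ0.le hψ1.le hm0 hm1
  rw [mul_pow, mul_pow, Real.sq_sqrt hA0, Real.sq_sqrt hN0] at main
  rw [BB, ← hA, hww, hpp]
  have d1 := mul_le_mul_of_nonneg_left c1 (by positivity : 0 ≤ t ^ 2 * m)
  have d2 := mul_le_mul_of_nonneg_left c2 (by positivity : 0 ≤ t ^ 2 * ψ)
  have d3 := mul_le_mul_of_nonneg_left c3 (by positivity : 0 ≤ t ^ 2 * m)
  have s2 : t ^ 2 * ψ * -(‖k‖ * ‖E‖ * (Real.sqrt N * Real.sqrt A)) = - (‖k‖ * (ψ * Real.sqrt N * (t * Real.sqrt A))) := by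
    linear_combination (-(‖k‖ * (ψ * Real.sqrt N * (t * Real.sqrt A)))) * hEn
  have s3 : t ^ 2 * m * (‖k‖ * ‖E‖ * ‖u x‖ * Real.sqrt N) = ‖k‖ * (m * (t * ‖u x‖) * Real.sqrt N) := by
    linear_combination (‖k‖ * (m * (t * ‖u x‖) * Real.sqrt N)) * hEn
  rw [s2] at d2
  rw [s3] at d3
  linarith

theorem BB_nonneg (hk : 0 < k.im) (R : ℝ) (x : E3) : 0 ≤ BB k u R x := by
  have h1 := ww_pos k R ‖x‖
  have h2 := pp_nonpos k hk R ‖x‖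
  have h3 : 0 ≤ - pp k R ‖x‖ := by linarith
  unfold BB
  positivity

theorem BB_dec (S : Setup k u f) (R : ℝ) : Dec (k.im / 4) 2 (fun x => (BB k u R x : ℂ)) := by
  have hw := Dec.ww k R
  have hp := (Dec.pp k S.hk R).neg
  have hV := VV_dec S
  have a1 := ((Dec.const ((k.im / 2 : ℝ) : ℂ)).mul (hw.mul (Dec.sum fun i => (hV i).mul (hV i).conj))).cast (c := k.im / 4) (by ring)
  have a2 := ((Dec.const ((‖k‖ ^ 2 / 2 : ℝ) : ℂ)).mul (hp.mul (S.hub.mul S.hub.conj))).cast (c := k.im / 4) (by ring)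
  have := (a1.mono (m := 2) (by norm_num)).add (a2.mono (m := 2) (by norm_num))
  convert! this using 2 with x
  simp only [Complex.mul_conj, Complex.normSq_eq_norm_sq, BB]
  push_cast
  rfl

theorem BB_meas (S : Setup k u f) (R : ℝ) : Measurable (BB k u R) := by
  have := Complex.measurable_re.comp (BB_dec S R).1
  exact this

theorem BB_integrable (S : Setup k u f) (R : ℝ) : Integrable (BB k u R) := by
  have := ((BB_dec S R).integrable (by have := S.hk; positivity)).re
  exact this

theorem energy (S : Setup k u f) (R : ℝ) :
    ∫ x, BB k u R x ≤ 2 * ‖k‖ ^ 2 / k.im * ∫ x, ∑ i, ‖f i x‖ ^ 2 := by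
  obtain ⟨i1, z1⟩ := S1_int S R
  obtain ⟨i2, z2⟩ := S2_int S R
  have hB := BB_integrable S R
  have hf : Integrable (fun x => ∑ i, ‖f i x‖ ^ 2) := by
    refine integrable_finsetSum _ fun i _ => ?_
    have hc := (S.hf i).continuous
    refine Continuous.integrable_of_hasCompactSupport (by fun_prop) ?_
    exact (S.hfs i).comp_left (g := fun z : ℂ => ‖z‖ ^ 2) (by simp)
  have j1 : Integrable (fun x => (Complex.I * (starRingEnd ℂ) k * S1 k u f R x).re) := (i1.const_mul _).re
  have j2 : Integrable (fun x => ‖k‖ ^ 2 * (S2 k u R x).re) := i2.re.const_mul _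
  have h := integral_mono_ae (hB.sub (hf.const_mul (2 * ‖k‖ ^ 2 / k.im))) (j1.sub j2)
    (by filter_upwards [ae_ne_zero] with x hx; exact Z_lower S.hk R x hx)
  have e1 : ∫ x, (Complex.I * (starRingEnd ℂ) k * S1 k u f R x).re = 0 := by
    have := integral_re (i1.const_mul (Complex.I * (starRingEnd ℂ) k))
    simp only [RCLike.re_to_complex] at this
    rw [this, integral_const_mul, z1]; simp
  have e2 : ∫ x, (S2 k u R x).re = 0 := by
    have := integral_re i2
    simp only [RCLike.re_to_complex] at this
    rw [this, z2]; simp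
  rw [integral_sub' hB (hf.const_mul _), integral_sub' j1 j2, integral_const_mul, integral_const_mul, e1, e2] at h
  linarith
end

theorem ofReal_integral_le {α : Type*} [MeasurableSpace α] {μ : Measure α} (g : α → ℝ) (hg : Integrable g μ) :
    ENNReal.ofReal (∫ x, g x ∂μ) ≤ ∫⁻ x, ENNReal.ofReal (g x) ∂μ := by
  rw [integral_eq_lintegral_pos_part_sub_lintegral_neg_part hg]
  refine (ENNReal.ofReal_le_ofReal (sub_le_self _ ENNReal.toReal_nonneg)).trans ENNReal.ofReal_toReal_le

section
variable {k : ℂ} {u : E3 → ℂ} {f : Fin 3 → E3 → ℂ}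

theorem ray_real (η K W P U X q : ℝ) (hη : 0 < η) (hK : η ≤ K) (hW : 0 ≤ W) (hP : P ≤ 0)
    (hWP : η / 8 * W ≤ - P) (hX : 0 ≤ X) (hU : 0 ≤ U) (hq : -(U * X) ≤ q) :
    - (P * U ^ 2 + 2 * W * q) ≤ 20 / (K * η) * (η / 2 * (W * X ^ 2) + K ^ 2 / 2 * (- P * U ^ 2)) := by
  have hK0 : 0 < K := hη.trans_le hK
  have e : 20 / (K * η) * (η / 2 * (W * X ^ 2) + K ^ 2 / 2 * (- P * U ^ 2)) =
    10 * (W * X ^ 2 / K) + 10 * (K / η * (- P * U ^ 2)) := by field_simp; ring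
  rw [e]
  have h1 : -P * U ^ 2 ≤ K / η * (- P * U ^ 2) := by
    have : 1 ≤ K / η := by rw [le_div_iff₀ hη]; linarith
    have hn : 0 ≤ - P * U ^ 2 := mul_nonneg (by linarith) (sq_nonneg _)
    nlinarith
  have h2 : W * (K * U ^ 2) ≤ 8 * (K / η * (- P * U ^ 2)) := by
    have : W ≤ 8 / η * (- P) := by
      rw [div_mul_eq_mul_div, le_div_iff₀ hη]; linarith
    calc W * (K * U ^ 2) ≤ 8 / η * (- P) * (K * U ^ 2) := by gcongr
      _ = _ := by ring
  have h3 : W * (2 * (U * X)) ≤ W * (K * U ^ 2 + X ^ 2 / K) := by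
    gcongr
    have : 0 ≤ K * (U - X / K) ^ 2 := by positivity
    have e2 : K * (U - X / K) ^ 2 = K * U ^ 2 + X ^ 2 / K - 2 * (U * X) := by field_simp; ring
    linarith
  have h4 : 0 ≤ W * X ^ 2 / K := by positivity
  have h5 : W * (K * U ^ 2 + X ^ 2 / K) = W * (K * U ^ 2) + W * X ^ 2 / K := by ring
  have h6 : 2 * W * (-(U * X)) ≤ 2 * W * q := by gcongr
  have h9 : 0 ≤ K / η * (- P * U ^ 2) :=
    mul_nonneg (by positivity) (mul_nonneg (by linarith) (sq_nonneg _))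
  have h8 : -(P * U ^ 2 + 2 * W * q) = - P * U ^ 2 - 2 * W * q := by ring
  have h7 : 2 * W * (-(U * X)) = - (W * (2 * (U * X))) := by ring
  rw [h8]
  linarith

theorem ww_contDiff (k : ℂ) (R : ℝ) : ContDiff ℝ 1 (ww k R) := by
  have := psi_contDiff (k.im / 4) R
  unfold ww
  fun_prop

theorem ray_bound (S : Setup k u f) (R : ℝ) (hR : 0 < R) (s : E3) (hs : ‖s‖ = 1) :
    ENNReal.ofReal (R ^ 2 * (Real.exp (2 * k.im * R) * (1 / 2)) * ‖u (R • s)‖ ^ 2) ≤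
      ∫⁻ r in Set.Ioi (0 : ℝ), ENNReal.ofReal (r ^ 2) * ENNReal.ofReal (20 / (‖k‖ * k.im) * BB k u R (r • s)) := by
  have hk := S.hk
  have hKk : k.im ≤ ‖k‖ := (le_abs_self _).trans (Complex.abs_im_le_norm k)
  have hK0 : 0 < ‖k‖ := hk.trans_le hKk
  set L := ∫⁻ r in Set.Ioi (0 : ℝ), ENNReal.ofReal (r ^ 2) * ENNReal.ofReal (20 / (‖k‖ * k.im) * BB k u R (r • s)) with hL
  let p : ℝ → ℝ := fun r => r ^ 2 * ww k R r * ‖u (r • s)‖ ^ 2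
  have hpR : p R = R ^ 2 * (Real.exp (2 * k.im * R) * (1 / 2)) * ‖u (R • s)‖ ^ 2 := by
    simp only [p, ww, psi_self]
  rw [← hpR]
  have hus : ContDiff ℝ 1 (fun r : ℝ => u (r • s)) := by
    have : ContDiff ℝ 1 u := S.hu.of_le (by norm_num)
    fun_prop
  have hp : ContDiff ℝ 1 p := by
    have h1 := ww_contDiff k R
    have h2 := hus.norm_sq ℝ
    exact ((contDiff_id.pow 2).mul h1).mul h2
  have hder : ∀ r : ℝ, R < r → - deriv p r ≤ r ^ 2 * (20 / (‖k‖ * k.im) * BB k u R (r • s)) := by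
    intro r hr
    have hr0 : 0 < r := hR.trans hr
    have hn : ‖r • s‖ = r := by rw [norm_smul, hs, Real.norm_of_nonneg hr0.le, mul_one]
    have hx : r • s ≠ 0 := by rw [← norm_ne_zero_iff, hn]; exact hr0.ne'
    have d2 : HasDerivAt (fun r : ℝ => u (r • s)) (fderiv ℝ u (r • s) s) r := by
      have b1 : HasDerivAt (fun r : ℝ => r • s) s r := by
        simpa using (hasDerivAt_id r).smul_const s
      exact ((S.hu.differentiable (by norm_num) (r • s)).hasFDerivAt.comp_hasDerivAt r b1)
    have d3 := d2.norm_sq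
    have d4 := ((hasDerivAt_pow 2 r).mul (ww_deriv k R r)).mul d3
    set vr := ∑ i, nn i (r • s) * VV k u i (r • s) with hvr
    set D := fderiv ℝ u (r • s) s with hD
    have hrc : (r : ℂ) ≠ 0 := by exact_mod_cast hr0.ne'
    have hvD : vr = D + ((r : ℂ)⁻¹ - Complex.I * k) * u (r • s) := by
      rw [hD, fderiv_eq_sum_pd, hvr]
      have hni : ∀ i, nn i (r • s) = (s i : ℂ) := by
        intro i; simp only [nn, hn]; simp; field_simp
      have h1 := nn_sq (r • s) hx
      simp only [hni] at h1
      simp only [VV, hni, hn, Fin.sum_univ_three]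
      linear_combination (((r : ℂ)⁻¹ - Complex.I * k) * u (r • s)) * h1
    have hin : inner ℝ (u (r • s)) D = ((starRingEnd ℂ) (u (r • s)) * vr).re - (r⁻¹ + k.im) * ‖u (r • s)‖ ^ 2 := by
      rw [Complex.inner, hvD]
      have e : (starRingEnd ℂ) (u (r • s)) * (D + ((r : ℂ)⁻¹ - Complex.I * k) * u (r • s)) =
        (starRingEnd ℂ) (u (r • s)) * D + ((‖u (r • s)‖ ^ 2 : ℝ) : ℂ) * ((r : ℂ)⁻¹ - Complex.I * k) := by
        have := Complex.mul_conj (u (r • s))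
        rw [Complex.normSq_eq_norm_sq] at this
        linear_combination ((r : ℂ)⁻¹ - Complex.I * k) * this
      rw [e, Complex.add_re, Complex.re_ofReal_mul]
      have : ((r : ℂ)⁻¹ - Complex.I * k).re = r⁻¹ + k.im := by
        rw [← Complex.ofReal_inv]; simp
      rw [this, mul_comm D]
      ring
    have hd : deriv p r = r ^ 2 * (pp k R r * ‖u (r • s)‖ ^ 2 + 2 * ww k R r * ((starRingEnd ℂ) (u (r • s)) * vr).re) := by
      have := d4.deriv
      change deriv p r = _ at this
      rw [this, hin]
      simp
      field_simp
      ring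
    rw [hd, ← mul_neg]
    gcongr
    have hA0 : 0 ≤ ∑ i, ‖VV k u i (r • s)‖ ^ 2 := Finset.sum_nonneg fun i _ => by positivity
    have := ray_real k.im ‖k‖ (ww k R r) (pp k R r) ‖u (r • s)‖ (Real.sqrt (∑ i, ‖VV k u i (r • s)‖ ^ 2))
      ((starRingEnd ℂ) (u (r • s)) * vr).re hk hKk (ww_pos _ _ _).le (pp_nonpos k hk _ _) (le_pp k hk R r hr.le)
      (Real.sqrt_nonneg _) (norm_nonneg _) ?_
    · rw [Real.sq_sqrt hA0] at this
      rw [BB, hn]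
      exact this
    · have h := (abs_le.1 (Complex.abs_re_le_norm ((starRingEnd ℂ) (u (r • s)) * vr))).1
      refine le_trans ?_ h
      rw [neg_le_neg_iff, norm_mul, RCLike.norm_conj]
      gcongr
      have := cs3 (fun i => nn i (r • s)) (fun i => VV k u i (r • s))
      rw [nn_sum _ hx] at this; simpa using this
  have hb : ∀ b : ℝ, R ≤ b → ENNReal.ofReal (p R) ≤ ENNReal.ofReal (p b) + L := by
    intro b hRb
    have hc : Continuous (deriv p) := hp.continuous_deriv (by norm_num)
    have ftc := intervalIntegral.integral_deriv_eq_sub' (f := p) (f' := deriv p) (a := R) (b := b) rfl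
      (fun x _ => hp.differentiable (by norm_num) x) hc.continuousOn
    rw [intervalIntegral.integral_of_le hRb] at ftc
    have e : p R = p b + ∫ r in Set.Ioc R b, - deriv p r := by rw [integral_neg, ftc]; ring
    rw [e]
    refine ENNReal.ofReal_add_le.trans ?_
    gcongr
    have hi : IntegrableOn (fun r => - deriv p r) (Set.Ioc R b) :=
      (hc.neg.integrableOn_Icc (a := R) (b := b)).mono_set Set.Ioc_subset_Icc_self
    refine (ofReal_integral_le _ hi).trans ?_
    calc ∫⁻ r in Set.Ioc R b, ENNReal.ofReal (- deriv p r)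
        ≤ ∫⁻ r in Set.Ioc R b, ENNReal.ofReal (r ^ 2) * ENNReal.ofReal (20 / (‖k‖ * k.im) * BB k u R (r • s)) := by
          refine setLIntegral_mono' measurableSet_Ioc fun r hr => ?_
          rw [← ENNReal.ofReal_mul (sq_nonneg r)]
          exact ENNReal.ofReal_le_ofReal (hder r hr.1)
      _ ≤ L := lintegral_mono_set (fun r hr => hR.trans hr.1)
  have hlim : Filter.Tendsto p Filter.atTop (nhds 0) := by
    obtain ⟨_, A, hA, hAb⟩ := S.hub
    have h0 := (tendsto_rpow_mul_exp_neg_mul_atTop_nhds_zero 2 (k.im / 4) (by positivity)).const_mul (Real.exp (k.im / 4 * R) * A ^ 2)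
    rw [mul_zero] at h0
    refine squeeze_zero' (Filter.Eventually.of_forall fun r => ?_) ?_ h0
    · have := (ww_pos k R r).le
      simp only [p]; positivity
    · filter_upwards [Filter.eventually_gt_atTop 0] with r hr0
      have hn : ‖r • s‖ = r := by rw [norm_smul, hs, Real.norm_of_nonneg hr0.le, mul_one]
      have hx : r • s ≠ 0 := by rw [← norm_ne_zero_iff, hn]; exact hr0.ne'
      have h1 := hAb (r • s) hx
      rw [hn] at h1
      have h2 := ww_le k R r
      have h3 := ww_pos k R r
      simp only [pow_zero, one_mul] at h1
      calc p r ≤ r ^ 2 * (Real.exp (k.im / 4 * R) * Real.exp (-(k.im / 4 - 2 * k.im) * r)) * (A * Real.exp (-k.im * r)) ^ 2 := by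
            simp only [p]; gcongr
        _ = _ := by
            rw [mul_pow, ← Real.exp_nat_mul, show -(k.im / 4 - 2 * k.im) * r = -(k.im / 4) * r - ((2:ℕ):ℝ) * (-k.im * r) by push_cast; ring,
              Real.exp_sub]
            rw [show (r ^ (2:ℝ)) = r ^ 2 by exact_mod_cast Real.rpow_natCast r 2]
            field_simp
  have hlim2 : Filter.Tendsto (fun b => ENNReal.ofReal (p b) + L) Filter.atTop (nhds (0 + L)) := by
    refine Filter.Tendsto.add ?_ tendsto_const_nhds
    simpa using ENNReal.tendsto_ofReal hlim
  rw [zero_add] at hlim2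
  exact ge_of_tendsto hlim2 ((Filter.eventually_ge_atTop R).mono hb)

theorem sphere_bound (S : Setup k u f) (R : ℝ) (hR : 0 < R) :
    ∫⁻ s : sphere (0 : E3) 1, ENNReal.ofReal (R ^ 2 * (Real.exp (2 * k.im * R) * (1 / 2)) * ‖u (R • (s : E3))‖ ^ 2)
      ∂(volume : Measure E3).toSphere ≤
      ENNReal.ofReal (40 * (‖k‖ / k.im ^ 2) * ∫ x, ∑ i, ‖f i x‖ ^ 2) := by
  have hk := S.hk
  have hKk : k.im ≤ ‖k‖ := (le_abs_self _).trans (Complex.abs_im_le_norm k)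
  have hK0 : 0 < ‖k‖ := hk.trans_le hKk
  have hm := BB_meas S R
  calc _ ≤ ∫⁻ s : sphere (0 : E3) 1, ∫⁻ r in Set.Ioi (0 : ℝ), ENNReal.ofReal (r ^ 2) *
        ENNReal.ofReal (20 / (‖k‖ * k.im) * BB k u R (r • (s : E3))) ∂volume ∂(volume : Measure E3).toSphere :=
        lintegral_mono fun s => ray_bound S R hR s (by simp)
    _ = ∫⁻ x, ENNReal.ofReal (20 / (‖k‖ * k.im) * BB k u R x) :=
        (polar_lintegral (fun x => ENNReal.ofReal (20 / (‖k‖ * k.im) * BB k u R x)) (by fun_prop)).symm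
    _ = ENNReal.ofReal (∫ x, 20 / (‖k‖ * k.im) * BB k u R x) := by
        rw [ofReal_integral_eq_lintegral_ofReal ((BB_integrable S R).const_mul _)]
        refine Filter.Eventually.of_forall fun x => ?_
        have := BB_nonneg (u := u) hk R x
        simp only [Pi.zero_apply]
        positivity
    _ ≤ _ := by
        apply ENNReal.ofReal_le_ofReal
        rw [integral_const_mul]
        calc _ ≤ 20 / (‖k‖ * k.im) * (2 * ‖k‖ ^ 2 / k.im * ∫ x, ∑ i, ‖f i x‖ ^ 2) := by
              gcongr; exact energy S R
          _ = _ := by field_simp; ring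
end

theorem cv_dec (k : ℂ) (hk : 0 < k.im) (h : E3 → ℂ) (hc : Continuous h) (hs : HasCompactSupport h) :
    Dec k.im 0 (cv k h) := by
  obtain ⟨K, hK, hb⟩ := cv_bound k hk h hc hs
  have h0 : ContDiff ℝ ((0 : ℕ∞) : WithTop ℕ∞) h := by
    have := contDiff_zero (𝕜 := ℝ).2 hc
    exact_mod_cast this
  refine ⟨(cv_contDiff k hk (n := 0) h h0 hs).continuous.measurable, K, hK, fun x _ => ?_⟩
  simpa using hb x

theorem mk_setup (k : ℂ) (hk : 0 < k.im) (f : E3 → EuclideanSpace ℂ (Fin 3))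
    (hf : ContDiff ℝ (⊤ : ℕ∞) f) (hs : HasCompactSupport f) (h0 : (0 : E3) ∉ tsupport f) :
    Setup k (cv k (src k f)) (fun i x => f x i) := by
  have g2 := src_contDiff k f hf h0
  have gs := src_cs k f hs
  have g1 : ContDiff ℝ 1 (src k f) := g2.of_le (by norm_num)
  have p1 : ∀ i, ContDiff ℝ 1 (pd i (src k f)) := fun i => by
    have := pd_contDiff (n := 1) i (src k f) (by exact_mod_cast g2)
    exact_mod_cast this
  have p2 : ∀ i, ContDiff ℝ 0 (pd i (pd i (src k f))) := fun i => by
    have := pd_contDiff (n := 0) i (pd i (src k f)) (by exact_mod_cast p1 i)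
    exact_mod_cast this
  have e1 : ∀ i, pd i (cv k (src k f)) = cv k (pd i (src k f)) := fun i => cv_pd k hk _ g1 gs i
  have e2 : ∀ i, pd i (pd i (cv k (src k f))) = cv k (pd i (pd i (src k f))) := fun i => by
    rw [e1, cv_pd k hk _ (p1 i) (pd_cs i _ gs) i]
  refine ⟨hk, ?_, ?_, ?_, ?_, ?_, ?_, ?_⟩
  · have := cv_contDiff k hk (n := 2) (src k f) (by exact_mod_cast g2) gs
    exact_mod_cast this
  · exact cv_dec k hk _ g2.continuous gs
  · intro i; rw [e1]; exact cv_dec k hk _ (p1 i).continuous (pd_cs i _ gs)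
  · intro i; rw [e2]; exact cv_dec k hk _ (p2 i).continuous (pd_cs i _ (pd_cs i _ gs))
  · intro i; exact contDiff_infty.1 (f_comp_smooth f hf i) 1
  · intro i; exact hs.comp_left (g := fun v : EuclideanSpace ℂ (Fin 3) => v i) rfl
  · intro x hx
    have h := cv_helm k hk _ g2 gs x
    rw [src_eq k f hf x hx] at h
    simp only [nn]
    rw [div_eq_mul_inv] at h
    linear_combination h

theorem mu1_sq (k : ℂ) (f : E3 → EuclideanSpace ℂ (Fin 3)) (R : ℝ) (hR : 0 < R) (σ : E3) :
    ‖mu1 k f R σ‖ ^ 2 = 2 * (R ^ 2 * (Real.exp (2 * k.im * R) * (1 / 2)) * ‖cv k (src k f) (R • σ)‖ ^ 2) := by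
  rw [mu1_eq k f R hR σ, norm_mul, norm_mul, norm_exp_ik, Complex.norm_real, Real.norm_of_nonneg hR.le,
    mul_pow, mul_pow, ← Real.exp_nat_mul, show ((2 : ℕ) : ℝ) * (-k.im * -R) = 2 * k.im * R by push_cast; ring]
  ring

theorem final_sq (k : ℂ) (hk : 0 < k.im) (f : E3 → EuclideanSpace ℂ (Fin 3))
    (hf : ContDiff ℝ (⊤ : ℕ∞) f) (hs : HasCompactSupport f) (h0 : (0 : E3) ∉ tsupport f)
    (R : ℝ) (hR : 0 < R) :
    ∫ σ in sphere (0 : E3) 1, ‖mu1 k f R σ‖ ^ 2 ∂μH[2] ≤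
      163840 * (‖k‖ / k.im ^ 2) * ∫ y, ‖f y‖ ^ 2 := by
  have S := mk_setup k hk f hf hs h0
  have hfn : ∫ x, ∑ i, ‖f x i‖ ^ 2 = ∫ y, ‖f y‖ ^ 2 := by
    simp only [EuclideanSpace.norm_sq_eq]
  have hB := sphere_bound S R hR
  rw [hfn] at hB
  have hI : 0 ≤ ∫ y, ‖f y‖ ^ 2 := integral_nonneg fun y => by positivity
  have hle : ∫⁻ σ in sphere (0 : E3) 1, ENNReal.ofReal (‖mu1 k f R σ‖ ^ 2) ∂μH[2] ≤
      ENNReal.ofReal (163840 * (‖k‖ / k.im ^ 2) * ∫ y, ‖f y‖ ^ 2) := by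
    refine (sphere_lintegral_le _).trans ?_
    simp only [mu1_sq k f R hR]
    simp only [ENNReal.ofReal_mul (zero_le_two (α := ℝ))]
    rw [lintegral_const_mul' _ _ ENNReal.ofReal_ne_top]
    calc _ ≤ 2048 * (ENNReal.ofReal 2 * ENNReal.ofReal (40 * (‖k‖ / k.im ^ 2) * ∫ y, ‖f y‖ ^ 2)) := by
          gcongr
      _ = _ := by
          rw [← ENNReal.ofReal_mul (by norm_num), show (2048 : ENNReal) = ENNReal.ofReal 2048 by norm_num,
            ← ENNReal.ofReal_mul (by norm_num)]
          congr 1; ring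
  have h1 := norm_integral_le_lintegral_norm (μ := (μH[2] : Measure E3).restrict (sphere (0 : E3) 1)) (fun σ => ‖mu1 k f R σ‖ ^ 2)
  refine (le_abs_self _).trans (h1.trans ?_)
  refine ENNReal.toReal_le_of_le_ofReal (by positivity) ?_
  simpa using hle

/-- Uniform-in-`r` bound for `‖μ₁(r,·)‖_{L²(S²)}` in terms of
`‖f‖_{L²(ℝ³)}`, for `k ∈ ℂ⁺` and `f ∈ C_c^∞(ℝ³∖{0}; ℂ³)`. -/
theorem stmt_3 :
    ∃ C : ℝ, 0 < C ∧
      ∀ k : ℂ, 0 < k.im →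
        ∀ f : EuclideanSpace ℝ (Fin 3) → EuclideanSpace ℂ (Fin 3),
          ContDiff ℝ (⊤ : ℕ∞) f → HasCompactSupport f →
          (0 : EuclideanSpace ℝ (Fin 3)) ∉ tsupport f →
          ∀ r : ℝ, 0 < r →
            Real.sqrt (∫ σ in sphere (0 : EuclideanSpace ℝ (Fin 3)) 1,
                ‖mu1 k f r σ‖ ^ 2 ∂μH[2]) ≤
              C * Real.sqrt (1 / ‖k‖ ^ 2 + 1 / k.im ^ 2 + ‖k‖ / k.im ^ ((3 : ℝ) / 2)
                  + ‖k‖ / k.im ^ 2 + 1 / k.im) *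
                Real.sqrt (∫ y : EuclideanSpace ℝ (Fin 3), ‖f y‖ ^ 2) := by
  refine ⟨Real.sqrt 163840, by positivity, ?_⟩
  intro k hk f hf hs h0 r hr
  have h := final_sq k hk f hf hs h0 r hr
  have hI : 0 ≤ ∫ y, ‖f y‖ ^ 2 := integral_nonneg fun y => by positivity
  have hbr : ‖k‖ / k.im ^ 2 ≤ 1 / ‖k‖ ^ 2 + 1 / k.im ^ 2 + ‖k‖ / k.im ^ ((3 : ℝ) / 2)
                  + ‖k‖ / k.im ^ 2 + 1 / k.im := by
    have a1 : 0 ≤ 1 / ‖k‖ ^ 2 := by positivity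
    have a2 : 0 ≤ 1 / k.im ^ 2 := by positivity
    have a3 : 0 ≤ ‖k‖ / k.im ^ ((3 : ℝ) / 2) := by positivity
    have a4 : 0 ≤ 1 / k.im := by positivity
    linarith
  rw [← Real.sqrt_mul (by norm_num), ← Real.sqrt_mul' _ hI]
  apply Real.sqrt_le_sqrt
  refine h.trans ?_
  gcongr
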